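/- arXiv:1104.4940 — 2 statements merged into one kernel-verified Lean document; each statement's English description precedes it below -/
import Mathlib

section
/- The Airy jump matrix conjugates to a constant matrix: G_A(λ) = e^{T_A(λ)} G_A^{(0)} e^{−T_A(λ)}, where G_A^{(0)} is a constant matrix whose entries are only 0, +1, −1, T_A(λ) = diag(T_A^{(0)}, \vec T_A^{(1)},…,\vec T_A^{(n)}) with T_A^{(0)} := (1+Σ_{i=1}^n k_i)^{−1} Σ_{i=1}^n Σ_{ℓ=1}^{k_i} θ(a_i^{(ℓ)},λ_i) and \vec T_A^{(i)} := T_A^{(0)}·1 − diag(θ(a_i^{(1)},λ_i),…,θ(a_i^{(k_i)},λ_i)); moreover Tr T_A(λ) ≡ 0. -/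
open MeasureTheory Complex Filter Matrix

noncomputable section

/-- The Fredholm determinant `det(Id - K)` of an integral operator with kernel `K`,
defined through the Fredholm series expansion. -/
def fredholmDet {X : Type} [MeasurableSpace X] (μ : Measure X) (K : X → X → ℂ) : ℂ :=
  1 + ∑' m : ℕ, ((-1 : ℂ) ^ (m + 1) / (Nat.factorial (m + 1) : ℂ)) *
      ∫ x : Fin (m + 1) → X, (Matrix.of fun i j => K (x i) (x j)).det ∂(Measure.pi fun _ => μ)

/-- A continuous linear map between inner product spaces is Hilbert--Schmidt if the sums
`∑ ‖T v i‖²` over finite orthonormal families are uniformly bounded. -/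
def IsHilbertSchmidt {E F : Type} [NormedAddCommGroup E] [InnerProductSpace ℂ E]
    [NormedAddCommGroup F] [InnerProductSpace ℂ F] (T : E →L[ℂ] F) : Prop :=
  ∃ c : ℝ, ∀ (m : ℕ) (v : Fin m → E), Orthonormal ℂ v → ∑ i, ‖T (v i)‖ ^ 2 ≤ c

/-- An operator is trace class iff it is the composition of two Hilbert--Schmidt operators. -/
def IsTraceClass {E : Type} [NormedAddCommGroup E] [InnerProductSpace ℂ E]
    (T : E →L[ℂ] E) : Prop :=
  ∃ S₁ S₂ : E →L[ℂ] E, IsHilbertSchmidt S₁ ∧ IsHilbertSchmidt S₂ ∧ T = S₁.comp S₂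

/-- `T` is the integral operator on `L²(μ)` with kernel `K`. -/
def IsKernelOperator {X : Type} [MeasurableSpace X] (μ : Measure X) (K : X → X → ℂ)
    (T : Lp ℂ 2 μ →L[ℂ] Lp ℂ 2 μ) : Prop :=
  ∀ f : Lp ℂ 2 μ, (T f : X → ℂ) =ᵐ[μ] fun x => ∫ y, K x y * (f : X → ℂ) y ∂μ

end
noncomputable section

/-! ## The multi-time Airy process -/

/-- `θ(x,μ) = μ³/3 - xμ`. -/
def θA (x : ℝ) (μ : ℂ) : ℂ := μ ^ 3 / 3 - (x : ℂ) * μ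

/-- Parametrization of the contour `γ_R`: the ray from `∞ e^{iπ/3}` to `C` followed by the
ray from `C` to `∞ e^{-iπ/3}`. -/
def airyγR (C : ℝ) (t : ℝ) : ℂ :=
  (C : ℂ) + (if t ≤ 0 then (-t : ℂ) * Complex.exp (Complex.I * ((Real.pi / 3 : ℝ) : ℂ))
    else (t : ℂ) * Complex.exp (-(Complex.I * ((Real.pi / 3 : ℝ) : ℂ))))

/-- The tangent (velocity) vector of the parametrization of `γ_R`. -/
def airyγR' (t : ℝ) : ℂ :=
  if t ≤ 0 then -Complex.exp (Complex.I * ((Real.pi / 3 : ℝ) : ℂ))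
  else Complex.exp (-(Complex.I * ((Real.pi / 3 : ℝ) : ℂ)))

/-- The multi-interval `[a⁽¹⁾,a⁽²⁾] ∪ [a⁽³⁾,a⁽⁴⁾] ∪ …`, the last interval being `[a⁽ᵏ⁾,∞)`
if `k` is odd. -/
def multiInterval {k : ℕ} (a : Fin k → ℝ) : Set ℝ :=
  ⋃ (m : Fin k) (_ : (m : ℕ) % 2 = 0),
    if h : (m : ℕ) + 1 < k then Set.Icc (a m) (a ⟨(m : ℕ) + 1, h⟩) else Set.Ici (a m)

/-- The kernel `Ã_{ij}(x,y)`, a double contour integral over `γ_{R_i} = γ_R - τ_i` (in `μ`)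
and `iℝ` (in `λ`). -/
def airyTildeKer {n : ℕ} (C : ℝ) (τ : Fin n → ℝ) (i j : Fin n) (x y : ℝ) : ℂ :=
  (1 / (2 * (Real.pi : ℂ) * Complex.I)) ^ 2 *
    ∫ s : ℝ, airyγR' s *
      ∫ t : ℝ, Complex.I *
        (Complex.exp (θA x (airyγR C s - (τ i : ℂ)) - θA y (Complex.I * (t : ℂ))) /
          (Complex.I * (t : ℂ) + (τ j : ℂ) - (airyγR C s - (τ i : ℂ)) - (τ i : ℂ)))

/-- The Gaussian part `B_{ij}(x,y)` of the matrix Airy kernel (strictly upper triangular). -/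
def airyBKer {n : ℕ} (τ : Fin n → ℝ) (i j : Fin n) (x y : ℝ) : ℂ :=
  if τ i < τ j then
    ((1 / Real.sqrt (4 * Real.pi * (τ j - τ i)) : ℝ) : ℂ) *
      Complex.exp ((((τ j - τ i) ^ 3 / 12 - (x - y) ^ 2 / (4 * (τ j - τ i))
        - (τ j - τ i) * (x + y) / 2 : ℝ) : ℂ))
  else 0

/-- The matrix Airy kernel `A_{ij} = Ã_{ij} - B_{ij}`. -/
def airyAKer {n : ℕ} (C : ℝ) (τ : Fin n → ℝ) (i j : Fin n) (x y : ℝ) : ℂ :=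
  airyTildeKer C τ i j x y - airyBKer τ i j x y

/-- Counting-times-Lebesgue measure on `Fin n × ℝ`, realizing `⊕ᵢ L²(ℝ)` as scalar `L²`. -/
def finLineMeasure (n : ℕ) : Measure (Fin n × ℝ) :=
  (Measure.count : Measure (Fin n)).prod volume

/-- The scalar kernel of `χ_{vec I} A` on `Fin n × ℝ`. -/
def airyRestrictedKer {n : ℕ} (C : ℝ) (τ : Fin n → ℝ) (k : Fin n → ℕ)
    (a : ∀ i, Fin (k i) → ℝ) : (Fin n × ℝ) → (Fin n × ℝ) → ℂ := fun p q =>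
  Set.indicator (multiInterval (a p.1)) (fun _ => (1 : ℂ)) p.2 * airyAKer C τ p.1 q.1 p.2 q.2

/-- Parametrization domain of the contour `(⋃ᵢ (iℝ+τᵢ)) ∪ γ_R`. -/
abbrev airyDom (n : ℕ) := (Fin n × ℝ) ⊕ ℝ

/-- Row index for the `(1+Σᵢ kᵢ) × n` matrices `f_A`, `g_A`. -/
abbrev airyIdx (n : ℕ) (k : Fin n → ℕ) := Unit ⊕ (Σ i : Fin n, Fin (k i))

/-- Point on the contour corresponding to a parameter value. -/
def airyPt {n : ℕ} (C : ℝ) (τ : Fin n → ℝ) : airyDom n → ℂ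
  | Sum.inl (i, t) => (τ i : ℂ) + Complex.I * (t : ℂ)
  | Sum.inr t => airyγR C t

/-- Tangent vector of the contour at a parameter value. -/
def airyWt {n : ℕ} : airyDom n → ℂ
  | Sum.inl _ => Complex.I
  | Sum.inr t => airyγR' t

/-- The measure on the parametrization domain of the full Airy contour. -/
def airyDomMeasure (n : ℕ) : Measure (airyDom n) :=
  Measure.map Sum.inl (finLineMeasure n) + Measure.map Sum.inr volume

/-- The measure realizing `H = (⊕ᵢ L²(iℝ+τᵢ, ℂⁿ)) ⊕ L²(γ_R, ℂⁿ)` as a scalar `L²` space. -/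
def airyHMeasure (n : ℕ) : Measure (airyDom n × Fin n) :=
  (airyDomMeasure n).prod (Measure.count : Measure (Fin n))

/-- The matrix `f_A = (2πi)⁻¹ (f_{A,1},…,f_{A,n})`, as a function on the parametrized
contour (the indicator functions `χ_{γ_R}`, `χ_{iℝ+τᵢ}` being encoded by the component of
the domain). -/
def airyF {n : ℕ} (C : ℝ) (τ : Fin n → ℝ) (k : Fin n → ℕ) (a : ∀ i, Fin (k i) → ℝ) :
    airyDom n → airyIdx n k → Fin n → ℂ := fun y r i =>
  (1 / (2 * (Real.pi : ℂ) * Complex.I)) *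
    (match y, r with
    | Sum.inr t, Sum.inl _ => Complex.exp (θA 0 (airyγR C t - (τ i : ℂ)) / 2)
    | Sum.inl (i', s), Sum.inr ⟨i₀, ℓ⟩ =>
        if i₀ = i ∧ i' = i then
          Complex.exp ((a i₀ ℓ : ℂ) * (((τ i' : ℂ) + Complex.I * (s : ℂ)) - (τ i : ℂ)))
        else 0
    | _, _ => 0)

/-- The matrix `g_A = (g_{A,1},…,g_{A,n})` on the parametrized contour. -/
def airyG {n : ℕ} (C : ℝ) (τ : Fin n → ℝ) (k : Fin n → ℕ) (a : ∀ i, Fin (k i) → ℝ) :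
    airyDom n → airyIdx n k → Fin n → ℂ := fun y r j =>
  match y, r with
  | Sum.inl (j', t), Sum.inl _ =>
      if j' = j then Complex.exp (-θA 0 (((τ j' : ℂ) + Complex.I * (t : ℂ)) - (τ j : ℂ)))
      else 0
  | Sum.inl (j', t), Sum.inr ⟨i₀, s⟩ =>
      if j' = j ∧ i₀ < j then
        (-1 : ℂ) ^ (s : ℕ) *
          Complex.exp (θA (a i₀ s) (((τ j' : ℂ) + Complex.I * (t : ℂ)) - (τ i₀ : ℂ))
            - θA 0 (((τ j' : ℂ) + Complex.I * (t : ℂ)) - (τ j : ℂ)))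
      else 0
  | Sum.inr t, Sum.inr ⟨i₀, s⟩ =>
      if i₀ = j then
        (-1 : ℂ) ^ (s : ℕ) *
          Complex.exp (θA 0 (airyγR C t - (τ j : ℂ)) / 2 - (a i₀ s : ℂ) * (airyγR C t - (τ j : ℂ)))
      else 0
  | _, _ => 0

/-- The scalar kernel of the integrable operator
`K_A(λ,μ) = f_Aᵀ(λ) g_A(μ)/(λ-μ)` on the parametrized contour (the tangent weight of the
`μ`-variable realizes the complex contour measure). -/
def airyKA {n : ℕ} (C : ℝ) (τ : Fin n → ℝ) (k : Fin n → ℕ) (a : ∀ i, Fin (k i) → ℝ) :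
    (airyDom n × Fin n) → (airyDom n × Fin n) → ℂ := fun p q =>
  airyWt q.1 * (∑ r : airyIdx n k, airyF C τ k a p.1 r p.2 * airyG C τ k a q.1 r q.2) /
    (airyPt C τ p.1 - airyPt C τ q.1)

end
noncomputable section

/-- The jump matrix `G_A(λ)` of the Airy Riemann--Hilbert problem, as a function on the
parametrized contour (the indicators `χ_{γ_R}`, `χ_{iℝ+τᵢ}` being encoded by which
component of the contour the point lies on). -/
def airyGA {n : ℕ} (C : ℝ) (τ : Fin n → ℝ) (k : Fin n → ℕ) (a : ∀ i, Fin (k i) → ℝ) :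
    airyDom n → Matrix (airyIdx n k) (airyIdx n k) ℂ := fun y =>
  Matrix.of fun r c =>
    match y, r, c with
    -- first-row blocks (ε_{k_j} e^{θ(a_j, λ_j)})ᵀ χ_{γ_R}(λ):
    | Sum.inr t, Sum.inl _, Sum.inr ⟨j, ℓ⟩ =>
        (-1 : ℂ) ^ (ℓ : ℕ) * Complex.exp (θA (a j ℓ) (airyγR C t - (τ j : ℂ)))
    -- first-column blocks e^{-θ(a_i, λ_i)} χ_{iℝ+τ_i}(λ):
    | Sum.inl (i', t), Sum.inr ⟨i, s⟩, Sum.inl _ =>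
        if i' = i then
          Complex.exp (-θA (a i s) ((((τ i' : ℂ) + Complex.I * (t : ℂ))) - (τ i : ℂ)))
        else 0
    -- the blocks C_{i,j}(λ) for i > j:
    | Sum.inl (i', t), Sum.inr ⟨i, s⟩, Sum.inr ⟨j, u⟩ =>
        if i' = i ∧ j < i then
          (-1 : ℂ) ^ ((u : ℕ) + 1) *
            Complex.exp (-θA (a i s) ((((τ i' : ℂ) + Complex.I * (t : ℂ))) - (τ i : ℂ))
              + θA (a j u) ((((τ i' : ℂ) + Complex.I * (t : ℂ))) - (τ j : ℂ)))
        else 0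
    | _, _, _ => 0

/-- `f_A` as a `(1+Σ kᵢ) × n` matrix-valued function on the parametrized contour. -/
def airyFM {n : ℕ} (C : ℝ) (τ : Fin n → ℝ) (k : Fin n → ℕ) (a : ∀ i, Fin (k i) → ℝ)
    (y : airyDom n) : Matrix (airyIdx n k) (Fin n) ℂ :=
  Matrix.of fun r i => airyF C τ k a y r i

/-- `g_A` as a `(1+Σ kᵢ) × n` matrix-valued function on the parametrized contour. -/
def airyGM {n : ℕ} (C : ℝ) (τ : Fin n → ℝ) (k : Fin n → ℕ) (a : ∀ i, Fin (k i) → ℝ)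
    (y : airyDom n) : Matrix (airyIdx n k) (Fin n) ℂ :=
  Matrix.of fun r j => airyG C τ k a y r j

end
noncomputable section

/-- The diagonal entries of `T_A(λ)`:  the first entry is
`T_A⁰ = (1+Σᵢkᵢ)⁻¹ Σᵢ Σ_ℓ θ(a_i^{(ℓ)}, λ_i)` and the entry of the `(i,ℓ)`-block is
`T_A⁰ - θ(a_i^{(ℓ)}, λ_i)`. -/
def airyTAdiag {n : ℕ} (τ : Fin n → ℝ) (k : Fin n → ℕ) (a : ∀ i, Fin (k i) → ℝ)
    (r : airyIdx n k) (z : ℂ) : ℂ :=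
  (1 + (∑ i, k i : ℕ) : ℂ)⁻¹ * (∑ i, ∑ ℓ : Fin (k i), θA (a i ℓ) (z - (τ i : ℂ)))
    - (match r with
      | Sum.inl _ => 0
      | Sum.inr ⟨i, ℓ⟩ => θA (a i ℓ) (z - (τ i : ℂ)))

/-- The diagonal traceless matrix `T_A(λ)`. -/
def airyTA {n : ℕ} (τ : Fin n → ℝ) (k : Fin n → ℕ) (a : ∀ i, Fin (k i) → ℝ) (z : ℂ) :
    Matrix (airyIdx n k) (airyIdx n k) ℂ :=
  Matrix.diagonal fun r => airyTAdiag τ k a r z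

end
noncomputable section

/-- The connected component of the Airy contour a given point belongs to
(one of the `n` lines `iℝ + τ_i`, or `γ_R`). -/
def airyPiece {n : ℕ} : airyDom n → Fin n ⊕ Unit :=
  Sum.elim (fun p => Sum.inl p.1) (fun _ => Sum.inr ())

end
noncomputable section

/-- The constant matrix `G_A⁽⁰⁾` on each connected component of the Airy contour. -/
def airyG0 {n : ℕ} (k : Fin n → ℕ) (pc : Fin n ⊕ Unit) :
    Matrix (airyIdx n k) (airyIdx n k) ℂ :=
  Matrix.of fun r c =>
    match pc, r, c with
    | Sum.inr _, Sum.inl _, Sum.inr ⟨_, ℓ⟩ => (-1 : ℂ) ^ (ℓ : ℕ)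
    | Sum.inl i', Sum.inr ⟨i, _⟩, Sum.inl _ => if i' = i then 1 else 0
    | Sum.inl i', Sum.inr ⟨i, _⟩, Sum.inr ⟨j, u⟩ =>
        if i' = i ∧ j < i then (-1 : ℂ) ^ ((u : ℕ) + 1) else 0
    | _, _, _ => 0

theorem airyG0_entry {n : ℕ} (k : Fin n → ℕ) (pc : Fin n ⊕ Unit) (r c : airyIdx n k) :
    airyG0 k pc r c = 0 ∨ airyG0 k pc r c = 1 ∨ airyG0 k pc r c = -1 := by
  rcases pc with i' | _ <;> rcases r with _ | ⟨i, s⟩ <;> rcases c with _ | ⟨j, u⟩ <;>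
    simp only [airyG0, Matrix.of_apply, true_or]
  · split_ifs <;> simp
  · split_ifs
    · exact Or.inr (neg_one_pow_eq_or ℂ _)
    · exact Or.inl rfl
  · exact Or.inr (neg_one_pow_eq_or ℂ _)

theorem trace_airyTA {n : ℕ} (τ : Fin n → ℝ) (k : Fin n → ℕ) (a : ∀ i, Fin (k i) → ℝ)
    (z : ℂ) : Matrix.trace (airyTA τ k a z) = 0 := by
  have hk : (1 + (∑ i, k i : ℕ) : ℂ) ≠ 0 := by
    rw [add_comm]
    exact Nat.cast_add_one_ne_zero _
  have hcard : (Fintype.card (airyIdx n k) : ℂ) = 1 + (∑ i, k i : ℕ) := by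
    simp [airyIdx]
  simp only [airyTA, Matrix.trace_diagonal, airyTAdiag, Finset.sum_sub_distrib,
    Finset.sum_const, Finset.card_univ, nsmul_eq_mul, hcard, Fintype.sum_sum_type,
    Fintype.sum_sigma, smul_zero, zero_add]
  rw [mul_inv_cancel_left₀ hk]
  simp

theorem airyGA_eq_conj {n : ℕ} (C : ℝ) (τ : Fin n → ℝ) (k : Fin n → ℕ)
    (a : ∀ i, Fin (k i) → ℝ) (y : airyDom n) :
    airyGA C τ k a y
      = Matrix.diagonal (fun r => Complex.exp (airyTAdiag τ k a r (airyPt C τ y)))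
          * airyG0 k (airyPiece y) *
        Matrix.diagonal (fun r => Complex.exp (-airyTAdiag τ k a r (airyPt C τ y))) := by
  ext r c
  rw [Matrix.mul_diagonal, Matrix.diagonal_mul, mul_right_comm, ← Complex.exp_add, mul_comm]
  rcases y with ⟨i', t⟩ | t <;> rcases r with _ | ⟨i, s⟩ <;> rcases c with _ | ⟨j, u⟩ <;>
    simp only [airyGA, airyG0, airyPiece, airyPt, airyTAdiag, Matrix.of_apply, Sum.elim_inl,
      Sum.elim_inr, zero_mul, ite_mul, one_mul]
  all_goals
    congr 2
    ring_nf

/-- The Airy jump matrix conjugates to a constant matrix: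
`G_A(λ) = e^{T_A(λ)} G_A⁽⁰⁾ e^{-T_A(λ)}` where `G_A⁽⁰⁾` is constant on each piece of the
contour with entries `0, +1, -1` only; moreover `Tr T_A(λ) ≡ 0`. -/
theorem airy_jump_conjugation (n : ℕ) (τ : Fin n → ℝ) (hτ : StrictMono τ)
    (C : ℝ) (hC : ∀ j, τ j < C) (k : Fin n → ℕ) (a : ∀ i, Fin (k i) → ℝ)
    (ha : ∀ i, StrictMono (a i)) :
    (∀ z : ℂ, Matrix.trace (airyTA τ k a z) = 0) ∧
    (∃ G0 : Fin n ⊕ Unit → Matrix (airyIdx n k) (airyIdx n k) ℂ,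
      (∀ pc r c, G0 pc r c = 0 ∨ G0 pc r c = 1 ∨ G0 pc r c = -1) ∧
      (∀ y : airyDom n,
        airyGA C τ k a y
          = Matrix.diagonal (fun r => Complex.exp (airyTAdiag τ k a r (airyPt C τ y)))
              * G0 (airyPiece y) *
            Matrix.diagonal (fun r => Complex.exp (-airyTAdiag τ k a r (airyPt C τ y))))) := by
  exact ⟨trace_airyTA τ k a, airyG0 k, airyG0_entry k, airyGA_eq_conj C τ k a⟩

end
end

section
/- The Fredholm determinant of the multi-time matrix Pearcey operator restricted to the multi-intervals equals the Fredholm determinant of an integrable (IIKS) operator: det(Id − χ_{\vec J}P) = det(Id − K_P), where K_P is the integrable operator on V = L²(iℝ,ℂⁿ) ⊕ L²(γ_L∪γ_R,ℂⁿ) with kernel K_P(λ,μ) = f_P^T(λ)g_P(μ)/(λ−μ). -/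
open MeasureTheory Complex Filter Matrix

noncomputable section

/-! ## The multi-time Pearcey process -/

/-- `Θ_i(x,μ) = μ⁴/4 - τ_i μ²/2 - xμ`. -/
def ΘP (τi : ℝ) (x : ℝ) (μ : ℂ) : ℂ :=
  μ ^ 4 / 4 - (τi : ℂ) * μ ^ 2 / 2 - (x : ℂ) * μ

/-- Parametrization of the Pearcey contour `γ_R` (the rays from `∞e^{iπ/4}` to `0` and
from `0` to `∞e^{-iπ/4}`); `γ_L = -γ_R`. -/
def pγR (t : ℝ) : ℂ :=
  if t ≤ 0 then (-t : ℂ) * Complex.exp (Complex.I * ((Real.pi / 4 : ℝ) : ℂ))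
  else (t : ℂ) * Complex.exp (-(Complex.I * ((Real.pi / 4 : ℝ) : ℂ)))

/-- Tangent vector of the parametrization of the Pearcey `γ_R`. -/
def pγR' (t : ℝ) : ℂ :=
  if t ≤ 0 then -Complex.exp (Complex.I * ((Real.pi / 4 : ℝ) : ℂ))
  else Complex.exp (-(Complex.I * ((Real.pi / 4 : ℝ) : ℂ)))

/-- The kernel `P̃_{ij}(x,y)`: a double contour integral over `γ_L ∪ γ_R` (in `μ`)
and `iℝ` (in `λ`). -/
def pearceyTildeKer {n : ℕ} (τ : Fin n → ℝ) (i j : Fin n) (x y : ℝ) : ℂ :=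
  (1 / (2 * (Real.pi : ℂ) * Complex.I)) ^ 2 *
    ((∫ s : ℝ, (-pγR' s) *
        ∫ t : ℝ, Complex.I *
          (Complex.exp (ΘP (τ i) x (-pγR s) - ΘP (τ j) y (Complex.I * (t : ℂ))) /
            (Complex.I * (t : ℂ) - (-pγR s))))
      + ∫ s : ℝ, pγR' s *
          ∫ t : ℝ, Complex.I *
            (Complex.exp (ΘP (τ i) x (pγR s) - ΘP (τ j) y (Complex.I * (t : ℂ))) /
              (Complex.I * (t : ℂ) - pγR s)))

/-- The Gaussian part `Q_{ij}(x,y)` of the matrix Pearcey kernel. -/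
def pearceyQKer {n : ℕ} (τ : Fin n → ℝ) (i j : Fin n) (x y : ℝ) : ℂ :=
  if τ i < τ j then
    ((1 / Real.sqrt (2 * Real.pi * (τ j - τ i)) : ℝ) : ℂ) *
      Complex.exp (((-(x - y) ^ 2 / (2 * (τ j - τ i)) : ℝ) : ℂ))
  else 0

/-- The matrix Pearcey kernel `P_{ij} = P̃_{ij} - Q_{ij}`. -/
def pearceyPKer {n : ℕ} (τ : Fin n → ℝ) (i j : Fin n) (x y : ℝ) : ℂ :=
  pearceyTildeKer τ i j x y - pearceyQKer τ i j x y

/-- The scalar kernel of `χ_{vec J} P` on `Fin n × ℝ` (here every `J_j` is a finite union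
of bounded intervals, encoded by its `2k_j` endpoints). -/
def pearceyRestrictedKer {n : ℕ} (τ : Fin n → ℝ) (k : Fin n → ℕ)
    (a : ∀ i, Fin (2 * k i) → ℝ) : (Fin n × ℝ) → (Fin n × ℝ) → ℂ := fun p q =>
  Set.indicator (multiInterval (a p.1)) (fun _ => (1 : ℂ)) p.2 * pearceyPKer τ p.1 q.1 p.2 q.2

/-- Parametrization domain of the Pearcey contour `iℝ ∪ γ_L ∪ γ_R`
(`Sum.inl` is `iℝ`; `Sum.inr (false, ·)` is `γ_L`, `Sum.inr (true, ·)` is `γ_R`). -/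
abbrev pDom := ℝ ⊕ (Bool × ℝ)

/-- Row index for the `(1+Σᵢ 2kᵢ) × n` matrices `f_P`, `g_P`. -/
abbrev pIdx (n : ℕ) (k : Fin n → ℕ) := Unit ⊕ (Σ i : Fin n, Fin (2 * k i))

/-- Point on the Pearcey contour corresponding to a parameter value. -/
def pPt : pDom → ℂ
  | Sum.inl t => Complex.I * (t : ℂ)
  | Sum.inr (b, t) => if b then pγR t else -pγR t

/-- Tangent vector of the Pearcey contour at a parameter value. -/
def pWt : pDom → ℂ
  | Sum.inl _ => Complex.I
  | Sum.inr (b, t) => if b then pγR' t else -pγR' t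

/-- The measure on the parametrization domain of the Pearcey contour. -/
def pDomMeasure : Measure pDom :=
  Measure.map Sum.inl volume
    + Measure.map Sum.inr ((Measure.count : Measure Bool).prod volume)

/-- The measure realizing `V = L²(iℝ,ℂⁿ) ⊕ L²(γ_L∪γ_R,ℂⁿ)` as a scalar `L²` space. -/
def pVMeasure (n : ℕ) : Measure (pDom × Fin n) :=
  pDomMeasure.prod (Measure.count : Measure (Fin n))

/-- The matrix `f_P = (2πi)⁻¹(f_{P,1},…,f_{P,n})` on the parametrized Pearcey contour. -/
def pearceyF {n : ℕ} (τ : Fin n → ℝ) (k : Fin n → ℕ) (a : ∀ i, Fin (2 * k i) → ℝ) :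
    pDom → pIdx n k → Fin n → ℂ := fun y r i =>
  (1 / (2 * (Real.pi : ℂ) * Complex.I)) *
    (match y, r with
    | Sum.inr (b, t), Sum.inl _ => Complex.exp (ΘP (τ i) 0 (pPt (Sum.inr (b, t))) / 2)
    | Sum.inl t, Sum.inr ⟨i₀, ℓ⟩ =>
        if i₀ = i then Complex.exp ((a i₀ ℓ : ℂ) * (Complex.I * (t : ℂ))) else 0
    | _, _ => 0)

/-- The matrix `g_P = (g_{P,1},…,g_{P,n})` on the parametrized Pearcey contour. -/
def pearceyG {n : ℕ} (τ : Fin n → ℝ) (k : Fin n → ℕ) (a : ∀ i, Fin (2 * k i) → ℝ) :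
    pDom → pIdx n k → Fin n → ℂ := fun y r j =>
  match y, r with
  | Sum.inl t, Sum.inl _ => Complex.exp (-ΘP (τ j) 0 (Complex.I * (t : ℂ)))
  | Sum.inl t, Sum.inr ⟨i₀, s⟩ =>
      if i₀ < j then
        (-1 : ℂ) ^ (s : ℕ) *
          Complex.exp (-(a i₀ s : ℂ) * (Complex.I * (t : ℂ))
            + ((τ j - τ i₀ : ℝ) : ℂ) * (Complex.I * (t : ℂ)) ^ 2 / 2)
      else 0
  | Sum.inr (b, t), Sum.inr ⟨i₀, s⟩ =>
      if i₀ = j then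
        (-1 : ℂ) ^ (s : ℕ) *
          Complex.exp (ΘP (τ j) 0 (pPt (Sum.inr (b, t))) / 2
            - (a i₀ s : ℂ) * pPt (Sum.inr (b, t)))
      else 0
  | _, _ => 0

/-- The scalar kernel of the integrable operator `K_P(λ,μ) = f_Pᵀ(λ) g_P(μ)/(λ-μ)` on the
parametrized Pearcey contour. -/
def pearceyKP {n : ℕ} (τ : Fin n → ℝ) (k : Fin n → ℕ) (a : ∀ i, Fin (2 * k i) → ℝ) :
    (pDom × Fin n) → (pDom × Fin n) → ℂ := fun p q =>
  pWt q.1 * (∑ r : pIdx n k, pearceyF τ k a p.1 r p.2 * pearceyG τ k a q.1 r q.2) /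
    (pPt p.1 - pPt q.1)

end

open scoped Topology

open scoped ComplexOrder in
/-- Hadamard's inequality for a matrix with entries in the unit disc. -/
theorem norm_det_le_of_norm_entry_le_one {N : ℕ} (M : Matrix (Fin N) (Fin N) ℂ)
    (h : ∀ i j, ‖M i j‖ ≤ 1) : ‖M.det‖ ≤ √((N : ℝ) ^ N) := by
  rcases Nat.eq_zero_or_pos N with rfl | hN
  · simp
  have hNR : (0 : ℝ) < N := by exact_mod_cast hN
  have hP := Matrix.posSemidef_self_mul_conjTranspose M
  have hdet : ((‖M.det‖ ^ 2 : ℝ) : ℂ) = ((∏ i, hP.isHermitian.eigenvalues i : ℝ) : ℂ) := by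
    have := hP.isHermitian.det_eq_prod_eigenvalues
    rw [det_mul, det_conjTranspose] at this
    push_cast
    rw [← Complex.mul_conj']
    simpa using this
  have htr : ((∑ i, hP.isHermitian.eigenvalues i : ℝ) : ℂ)
      = ((∑ i, ∑ j, ‖M i j‖ ^ 2 : ℝ) : ℂ) := by
    have := hP.isHermitian.trace_eq_sum_eigenvalues
    push_cast
    rw [show (∑ i, (hP.isHermitian.eigenvalues i : ℂ)) = _ from this.symm]
    simp only [trace, diag_apply, mul_apply, conjTranspose_apply]
    refine Finset.sum_congr rfl fun i _ => Finset.sum_congr rfl fun j _ => ?_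
    rw [← Complex.mul_conj']; rfl
  have hdet' := Complex.ofReal_injective hdet
  have htr' := Complex.ofReal_injective htr
  have hev := hP.eigenvalues_nonneg
  have hsum : ∑ i, hP.isHermitian.eigenvalues i ≤ N * N := by
    rw [htr']
    calc _ ≤ ∑ i : Fin N, ∑ j : Fin N, (1 : ℝ) := by
          gcongr with i _ j _
          exact pow_le_one₀ (norm_nonneg _) (h i j)
      _ = _ := by simp
  have hamgm := Real.geom_mean_le_arith_mean_weighted Finset.univ (fun _ : Fin N => (1 / N : ℝ))
    hP.isHermitian.eigenvalues (fun _ _ => by positivity) (by simp [hNR.ne']) (fun i _ => hev i)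
  have h1 : ∏ i, hP.isHermitian.eigenvalues i ≤ (N : ℝ) ^ N := by
    calc ∏ i, hP.isHermitian.eigenvalues i
        = (∏ i, hP.isHermitian.eigenvalues i ^ (1 / N : ℝ)) ^ N := by
          rw [← Finset.prod_pow]
          refine Finset.prod_congr rfl fun i _ => ?_
          rw [one_div, Real.rpow_inv_natCast_pow (hev i) hN.ne']
      _ ≤ (∑ i, (1 / N : ℝ) * hP.isHermitian.eigenvalues i) ^ N := by
          gcongr
          exact Finset.prod_nonneg fun i _ => Real.rpow_nonneg (hev i) _
      _ ≤ (N : ℝ) ^ N := by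
          rw [← Finset.mul_sum]
          gcongr
          · exact mul_nonneg (by positivity) (Finset.sum_nonneg fun i _ => hev i)
          · rw [one_div, inv_mul_le_iff₀ hNR]; exact hsum
  exact Real.le_sqrt_of_sq_le (hdet'.trans_le h1)

/-- Hadamard's inequality for a matrix whose entries are dominated by a rank-one matrix. -/
theorem norm_det_le_of_norm_entry_le_mul {N : ℕ} (M : Matrix (Fin N) (Fin N) ℂ) (r s : Fin N → ℝ)
    (hr : ∀ i, 0 ≤ r i) (hs : ∀ i, 0 ≤ s i) (h : ∀ i j, ‖M i j‖ ≤ r i * s j) :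
    ‖M.det‖ ≤ √((N : ℝ) ^ N) * ∏ i, r i * s i := by
  let M' : Matrix (Fin N) (Fin N) ℂ := of fun i j => M i j / ((r i : ℂ) * s j)
  have hM : M = of fun i j => (s j : ℂ) * (of fun i j => (r i : ℂ) * M' i j) i j := by
    ext i j
    by_cases h0 : (r i : ℂ) * s j = 0
    · have h0' : r i * s j = 0 := by exact_mod_cast h0
      have : M i j = 0 := norm_le_zero_iff.1 (h0' ▸ h i j)
      simp [M', this]
    · simp only [M', of_apply]
      rw [mul_left_comm, ← mul_assoc, mul_div_cancel₀ _ h0]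
  have hM' : ∀ i j, ‖M' i j‖ ≤ 1 := by
    intro i j
    simp only [M', of_apply, norm_div, norm_mul, Complex.norm_real, Real.norm_eq_abs,
      abs_of_nonneg (hr i), abs_of_nonneg (hs j)]
    exact div_le_one_of_le₀ (h i j) (mul_nonneg (hr i) (hs j))
  rw [hM, det_mul_row, det_mul_column, norm_mul, norm_mul]
  have e1 : ‖∏ i, (s i : ℂ)‖ = ∏ i, s i := by
    rw [norm_prod]; exact Finset.prod_congr rfl fun i _ => by simp [abs_of_nonneg (hs i)]
  have e2 : ‖∏ i, (r i : ℂ)‖ = ∏ i, r i := by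
    rw [norm_prod]; exact Finset.prod_congr rfl fun i _ => by simp [abs_of_nonneg (hr i)]
  rw [e1, e2, Finset.prod_mul_distrib]
  have := norm_det_le_of_norm_entry_le_one M' hM'
  have p1 : 0 ≤ ∏ i, s i := Finset.prod_nonneg fun i _ => hs i
  have p2 : 0 ≤ ∏ i, r i := Finset.prod_nonneg fun i _ => hr i
  calc _ ≤ (∏ i, s i) * ((∏ i, r i) * √((N : ℝ) ^ N)) := by gcongr
    _ = _ := by ring

/-- Expansion of a determinant along its first column, in terms of row replacements in the
complementary block. -/
theorem det_succ_eq_sub_sum_updateRow {m : ℕ} (A : Matrix (Fin (m + 1)) (Fin (m + 1)) ℂ) :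
    A.det = A 0 0 * (A.submatrix Fin.succ Fin.succ).det
      - ∑ i : Fin m, A i.succ 0 *
          ((A.submatrix Fin.succ Fin.succ).updateRow i fun j => A 0 j.succ).det := by
  have key : ∀ B : Matrix (Fin (m + 1)) (Fin (m + 1)) ℂ, B 0 = Pi.single 0 1 →
      B.det = (B.submatrix Fin.succ Fin.succ).det := by
    intro B hB
    rw [det_succ_row_zero, Finset.sum_eq_single 0]
    · simp [hB]
    · intro j _ hj
      simp [hB, hj]
    · simp
  rw [det_eq_sum_mul_adjugate_col A 0, Fin.sum_univ_succ, sub_eq_add_neg, ← Finset.sum_neg_distrib]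
  congr 1
  · rw [adjugate_apply, key _ (by simp)]
    congr 2
  · refine Finset.sum_congr rfl fun i _ => ?_
    rw [adjugate_apply, ← mul_neg]
    congr 1
    have hsw := det_permute (Equiv.swap 0 i.succ) (A.updateRow i.succ (Pi.single 0 1))
    rw [Equiv.Perm.sign_swap (Fin.succ_ne_zero i).symm] at hsw
    have h2 : ((A.updateRow i.succ (Pi.single 0 1)).submatrix (Equiv.swap 0 i.succ) id).det
        = ((A.submatrix Fin.succ Fin.succ).updateRow i fun j => A 0 j.succ).det := by
      rw [key]
      · congr 1
        ext a b
        by_cases hab : a = i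
        · subst hab; simp [updateRow_ne (Fin.succ_ne_zero a).symm]
        · have : a.succ ≠ i.succ := fun h => hab (Fin.succ_injective _ h)
          rw [submatrix_apply, submatrix_apply, Equiv.swap_apply_of_ne_of_ne (Fin.succ_ne_zero a) this]
          simp [hab]
      · ext b; simp
    rw [← h2, hsw]
    simp

/-- The determinant `det (Φᵢ(vᵢ, vⱼ))` in which the `i`-th row is built from the kernel `Φᵢ`. -/
noncomputable def rowDet {V : Type} {N : ℕ} (Φ : Fin N → V → V → ℂ) (v : Fin N → V) : ℂ :=
  (of fun i j => Φ i (v i) (v j)).det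

/-- The integral of `rowDet Φ` over all configurations of points. -/
noncomputable def rowDetIntegral {V : Type} [MeasurableSpace V] (μ : Measure V) {N : ℕ}
    (Φ : Fin N → V → V → ℂ) : ℂ :=
  ∫ v, rowDet Φ v ∂(Measure.pi fun _ => μ)

/-- The composition of two integral kernels. -/
noncomputable def kerComp {X Y Z : Type} [MeasurableSpace Y] (μ : Measure Y)
    (K : X → Y → ℂ) (L : Y → Z → ℂ) (x : X) (z : Z) : ℂ :=
  ∫ y, K x y * L y z ∂μ

/-- A measurable kernel dominated by the rank-one kernel `C r(x) s(y)`. -/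
structure IsDominatedKernel {X Y : Type} [MeasurableSpace X] [MeasurableSpace Y]
    (r : X → ℝ) (s : Y → ℝ) (C : ℝ) (K : X → Y → ℂ) : Prop where
  measurable : Measurable (Function.uncurry K)
  bound : ∀ x y, ‖K x y‖ ≤ C * (r x * s y)

section Kernels

variable {X Y Z : Type} [MeasurableSpace X] [MeasurableSpace Y] [MeasurableSpace Z]
  {r : X → ℝ} {s : Y → ℝ} {r' : Y → ℝ} {s' : Z → ℝ} {C C' : ℝ} {K : X → Y → ℂ} {L : Y → Z → ℂ}

theorem IsDominatedKernel.measurable_apply (hK : IsDominatedKernel r s C K) {α : Type}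
    [MeasurableSpace α] {f : α → X} {g : α → Y} (hf : Measurable f) (hg : Measurable g) :
    Measurable fun a => K (f a) (g a) :=
  hK.measurable.comp (hf.prodMk hg)

theorem IsDominatedKernel.add {K' : X → Y → ℂ} (hK : IsDominatedKernel r s C K)
    (hK' : IsDominatedKernel r s C' K') :
    IsDominatedKernel r s (C + C') (fun x y => K x y + K' x y) where
  measurable := hK.measurable.add hK'.measurable
  bound x y := (norm_add_le _ _).trans (by linarith [hK.bound x y, hK'.bound x y])

theorem IsDominatedKernel.const_mul (hK : IsDominatedKernel r s C K) (c : ℂ) :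
    IsDominatedKernel r s (‖c‖ * C) (fun x y => c * K x y) where
  measurable := hK.measurable.const_mul c
  bound x y := by
    rw [norm_mul, mul_assoc]
    exact mul_le_mul_of_nonneg_left (hK.bound x y) (norm_nonneg c)

theorem IsDominatedKernel.mono (hK : IsDominatedKernel r s C K) (hr : ∀ x, 0 ≤ r x)
    (hs : ∀ y, 0 ≤ s y) (hC : C ≤ C') : IsDominatedKernel r s C' K where
  measurable := hK.measurable
  bound x y := (hK.bound x y).trans
    (mul_le_mul_of_nonneg_right hC (mul_nonneg (hr x) (hs y)))

theorem IsDominatedKernel.integrable_mul {μ : Measure Y} (hK : IsDominatedKernel r s C K)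
    (hL : IsDominatedKernel r' s' C' L) (hint : Integrable (fun y => r' y * s y) μ)
    (x : X) (z : Z) : Integrable (fun y => K x y * L y z) μ := by
  refine (hint.const_mul (C * C' * (r x * s' z))).mono'
    ((hK.measurable_apply measurable_const measurable_id).mul
      (hL.measurable_apply measurable_id measurable_const)).aestronglyMeasurable
    (Eventually.of_forall fun y => ?_)
  rw [norm_mul]
  calc ‖K x y‖ * ‖L y z‖ ≤ (C * (r x * s y)) * (C' * (r' y * s' z)) :=
        mul_le_mul (hK.bound x y) (hL.bound y z) (norm_nonneg _)
          ((norm_nonneg _).trans (hK.bound x y))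
    _ = _ := by ring

theorem IsDominatedKernel.kerComp {μ : Measure Y} [SFinite μ] (hK : IsDominatedKernel r s C K)
    (hL : IsDominatedKernel r' s' C' L) (hint : Integrable (fun y => r' y * s y) μ) :
    IsDominatedKernel r s' (C * C' * ∫ y, r' y * s y ∂μ) (kerComp μ K L) where
  measurable := by
    have h : StronglyMeasurable fun p : (X × Z) × Y => K p.1.1 p.2 * L p.2 p.1.2 :=
      ((hK.measurable_apply (by fun_prop) (by fun_prop)).mul
        (hL.measurable_apply (by fun_prop) (by fun_prop))).stronglyMeasurable
    exact h.integral_prod_right.measurable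
  bound x z := by
    have := norm_integral_le_of_norm_le (hint.const_mul (C * C' * (r x * s' z)))
      (f := fun y => K x y * L y z) (Eventually.of_forall fun y => by
        rw [norm_mul]
        calc ‖K x y‖ * ‖L y z‖ ≤ (C * (r x * s y)) * (C' * (r' y * s' z)) :=
              mul_le_mul (hK.bound x y) (hL.bound y z) (norm_nonneg _)
                ((norm_nonneg _).trans (hK.bound x y))
          _ = _ := by ring)
    rw [integral_const_mul] at this
    unfold _root_.kerComp
    linarith

end Kernels

section RowDet

variable {V : Type} [MeasurableSpace V] {μ : Measure V} [SigmaFinite μ] {N : ℕ}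
  {r s : V → ℝ} {C : ℝ} {Φ : Fin N → V → V → ℂ}

theorem measurable_rowDet (hΦ : ∀ i, IsDominatedKernel r s C (Φ i)) : Measurable (rowDet Φ) := by
  unfold rowDet
  simp only [det_apply, of_apply]
  refine Finset.measurable_fun_sum _ fun σ _ => Measurable.const_smul
    (Finset.measurable_fun_prod _ fun i _ => ?_) _
  exact (hΦ _).measurable_apply (measurable_pi_apply _) (measurable_pi_apply _)

theorem norm_rowDet_le (hr : ∀ v, 0 ≤ r v) (hs : ∀ v, 0 ≤ s v) (hC : 0 ≤ C)
    (hΦ : ∀ i, IsDominatedKernel r s C (Φ i)) (v : Fin N → V) :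
    ‖rowDet Φ v‖ ≤ √((N : ℝ) ^ N) * ∏ i, C * (r (v i) * s (v i)) := by
  have := norm_det_le_of_norm_entry_le_mul (of fun i j => Φ i (v i) (v j))
    (fun i => C * r (v i)) (fun i => s (v i)) (fun i => mul_nonneg hC (hr _)) (fun i => hs _)
    (fun i j => by simpa only [mul_assoc] using! (hΦ i).bound (v i) (v j))
  simpa only [mul_assoc] using! this

theorem integrable_rowDet_bound (hrs : Integrable (fun v => r v * s v) μ) (D C : ℝ) :
    Integrable (fun v : Fin N → V => D * ∏ i, C * (r (v i) * s (v i))) (Measure.pi fun _ => μ) :=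
  (Integrable.fintype_prod (f := fun _ : Fin N => fun v => C * (r v * s v))
    (fun _ => hrs.const_mul C)).const_mul D

theorem integrable_rowDet (hr : ∀ v, 0 ≤ r v) (hs : ∀ v, 0 ≤ s v) (hC : 0 ≤ C)
    (hrs : Integrable (fun v => r v * s v) μ)
    (hΦ : ∀ i, IsDominatedKernel r s C (Φ i)) :
    Integrable (rowDet Φ) (Measure.pi fun _ => μ) :=
  (integrable_rowDet_bound hrs _ C).mono' (measurable_rowDet hΦ).aestronglyMeasurable
    (Eventually.of_forall (norm_rowDet_le hr hs hC hΦ))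

theorem norm_rowDetIntegral_le (hr : ∀ v, 0 ≤ r v) (hs : ∀ v, 0 ≤ s v) (hC : 0 ≤ C)
    (hrs : Integrable (fun v => r v * s v) μ)
    (hΦ : ∀ i, IsDominatedKernel r s C (Φ i)) :
    ‖rowDetIntegral μ Φ‖ ≤ √((N : ℝ) ^ N) * (C * ∫ v, r v * s v ∂μ) ^ N := by
  refine (norm_integral_le_of_norm_le (integrable_rowDet_bound hrs _ C)
    (Eventually.of_forall (norm_rowDet_le hr hs hC hΦ))).trans_eq ?_
  rw [integral_const_mul,
    integral_fintype_prod_eq_pow (𝕜 := ℝ) (fun v => C * (r v * s v)),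
    integral_const_mul, Fintype.card_fin]

end RowDet

theorem det_updateRow_eq_sum {N : ℕ} (A : Matrix (Fin N) (Fin N) ℂ) (i : Fin N) (b : Fin N → ℂ) :
    (A.updateRow i b).det = ∑ j, b j * adjugate A j i := by
  rw [det_eq_sum_mul_adjugate_row _ i]
  refine Finset.sum_congr rfl fun j _ => ?_
  rw [updateRow_self, adjugate_apply, adjugate_apply, updateRow_idem]

/-- Integrating out the first point, whose row is built from a kernel vanishing on the
diagonal. -/
theorem rowDetIntegral_cons {V : Type} [MeasurableSpace V] {μ : Measure V} [SigmaFinite μ] {N : ℕ}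
    {r s : V → ℝ} {C : ℝ} {F : V → V → ℂ} {Φ : Fin N → V → V → ℂ}
    (hr : ∀ v, 0 ≤ r v) (hs : ∀ v, 0 ≤ s v) (hC : 0 ≤ C)
    (hrs : Integrable (fun v => r v * s v) μ)
    (hF : IsDominatedKernel r s C F) (hΦ : ∀ i, IsDominatedKernel r s C (Φ i))
    (hF0 : ∀ v, F v v = 0) :
    rowDetIntegral μ (Fin.cons F Φ : Fin (N + 1) → V → V → ℂ)
      = -∑ i, rowDetIntegral μ (Function.update Φ i (kerComp μ (Φ i) F)) := by
  have hcons : ∀ i, IsDominatedKernel r s C ((Fin.cons F Φ : Fin (N + 1) → V → V → ℂ) i) := by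
    intro i
    refine Fin.cases ?_ (fun i => ?_) i
    · exact hF
    · exact hΦ i
  have hint := integrable_rowDet hr hs hC hrs hcons
  have hmp := (measurePreserving_piFinSuccAbove (fun _ : Fin (N + 1) => μ) 0).symm
  have hint' := (hmp.integrable_comp_emb (MeasurableEquiv.measurableEmbedding _)).2 hint
  simp only [Function.comp_def] at hint'
  unfold rowDetIntegral
  rw [← hmp.integral_comp', integral_prod_symm _ hint']
  have hcompD := (fun i => (hΦ i).kerComp hF hrs)
  set C₂ := max C (C * C * ∫ v, r v * s v ∂μ)
  have hup : ∀ i j, IsDominatedKernel r s C₂ (Function.update Φ i (kerComp μ (Φ i) F) j) := by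
    intro i j
    by_cases h : j = i
    · subst h; simpa using! (hcompD j).mono hr hs (le_max_right _ _)
    · simpa [h] using! (hΦ j).mono hr hs (le_max_left _ _)
  rw [← integral_finsetSum _ fun i _ => integrable_rowDet hr hs
    (hC.trans (le_max_left _ _)) hrs (hup i), ← integral_neg]
  refine integral_congr_ae (Eventually.of_forall fun v => ?_)
  have h1 : ∀ y : V, rowDet (Fin.cons F Φ : Fin (N + 1) → V → V → ℂ)
      ((MeasurableEquiv.piFinSuccAbove (fun _ => V) 0).symm (y, v))
      = -∑ i, ∑ j, adjugate (of fun a b => Φ a (v a) (v b)) j i * (Φ i (v i) y * F y (v j)) := by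
    intro y
    have hpt : (MeasurableEquiv.piFinSuccAbove (fun _ => V) 0).symm (y, v)
        = (Fin.cons y v : Fin (N + 1) → V) := by
      ext i; simp [MeasurableEquiv.piFinSuccAbove, Fin.insertNthEquiv]
    rw [hpt, rowDet, det_succ_eq_sub_sum_updateRow]
    simp only [of_apply, Fin.cons_zero, hF0, zero_mul, zero_sub, Fin.cons_succ]
    congr 1
    refine Finset.sum_congr rfl fun i _ => ?_
    rw [det_updateRow_eq_sum, Finset.mul_sum]
    refine Finset.sum_congr rfl fun j _ => ?_
    have : (of fun i j => (Fin.cons F Φ : Fin (N + 1) → V → V → ℂ) i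
        ((Fin.cons y v : Fin (N + 1) → V) i) ((Fin.cons y v : Fin (N + 1) → V) j)).submatrix
          Fin.succ Fin.succ = of fun a b => Φ a (v a) (v b) := by
      ext a b; simp
    rw [this]; ring
  simp only [h1]
  rw [integral_neg, integral_finsetSum _ fun i _ => integrable_finsetSum _ fun j _ =>
    ((hΦ i).integrable_mul hF hrs (v i) (v j)).const_mul _]
  congr 1
  refine Finset.sum_congr rfl fun i _ => ?_
  rw [integral_finsetSum _ fun j _ =>
    ((hΦ i).integrable_mul hF hrs (v i) (v j)).const_mul _]
  have h2 : (of fun a b => Function.update Φ i (kerComp μ (Φ i) F) a (v a) (v b))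
      = (of fun a b => Φ a (v a) (v b)).updateRow i fun j => kerComp μ (Φ i) F (v i) (v j) := by
    ext a b
    by_cases h : a = i
    · subst h; simp
    · simp [h]
  rw [rowDet, h2, det_updateRow_eq_sum]
  refine Finset.sum_congr rfl fun j _ => ?_
  rw [integral_const_mul, mul_comm]; rfl

theorem sqrt_pow_self_mul_pow_div_factorial_le (a : ℝ) (ha : 0 ≤ a) (n : ℕ) :
    n * (√((n : ℝ) ^ n) * a ^ n / n.factorial)
      ≤ √(Real.exp (16 * Real.exp 1 * a ^ 2)) * (1 / 2) ^ n := by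
  have hf : (0 : ℝ) < n.factorial := by exact_mod_cast n.factorial_pos
  have h1 : (n : ℝ) ^ n ≤ Real.exp 1 ^ n * n.factorial := by
    have := Real.pow_div_factorial_le_exp (n : ℝ) (by positivity) n
    rw [div_le_iff₀ hf] at this
    rwa [← Real.exp_nat_mul, mul_one]
  have h2 : (n : ℝ) ≤ 2 ^ n := by exact_mod_cast n.lt_two_pow_self.le
  have h3 := Real.pow_div_factorial_le_exp (16 * Real.exp 1 * a ^ 2) (by positivity) n
  rw [div_le_iff₀ hf] at h3
  refine (sq_le_sq₀ (by positivity) (by positivity)).1 ?_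
  rw [mul_pow, mul_pow, div_pow, mul_pow, Real.sq_sqrt (by positivity),
    Real.sq_sqrt (by positivity)]
  calc (n : ℝ) ^ 2 * ((n : ℝ) ^ n * (a ^ n) ^ 2 / (n.factorial : ℝ) ^ 2)
      ≤ (2 ^ n) ^ 2 * ((Real.exp 1 ^ n * n.factorial) * (a ^ n) ^ 2 / (n.factorial : ℝ) ^ 2) := by
        gcongr
    _ = (16 * Real.exp 1 * a ^ 2) ^ n * ((1 / 2) ^ n) ^ 2 / n.factorial := by
        have : (16 : ℝ) ^ n = (2 ^ n) ^ 2 * (2 ^ n) ^ 2 := by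
          rw [← pow_mul, ← pow_add, show n * 2 + n * 2 = 4 * n by ring, pow_mul]; norm_num
        have h4 : (2 : ℝ) ^ n * (1 / 2) ^ n = 1 := by rw [← mul_pow]; norm_num
        have h5 : (a ^ 2) ^ n = (a ^ n) ^ 2 := by rw [← pow_mul, mul_comm, pow_mul]
        rw [mul_pow, mul_pow, this, h5]
        calc _ = (2 ^ n) ^ 2 * Real.exp 1 ^ n * (a ^ n) ^ 2 / (n.factorial : ℝ) := by field_simp
          _ = (2 ^ n * (1 / 2) ^ n) ^ 2 * ((2 ^ n) ^ 2 * Real.exp 1 ^ n * (a ^ n) ^ 2)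
              / (n.factorial : ℝ) := by rw [h4]; ring
          _ = _ := by ring
    _ ≤ _ := by
        rw [div_le_iff₀ hf]
        calc _ ≤ Real.exp (16 * Real.exp 1 * a ^ 2) * n.factorial * ((1 / 2) ^ n) ^ 2 := by gcongr
          _ = _ := by ring

theorem hasDerivAt_det_add_smul {N : ℕ} (A : ℝ → Matrix (Fin N) (Fin N) ℂ)
    (B : Matrix (Fin N) (Fin N) ℂ) (t : ℝ)
    (hA : ∀ i j, HasDerivAt (fun t => A t i j) (B i j) t) :
    HasDerivAt (fun t => (A t).det) (∑ i, ((A t).updateRow i (B i)).det) t := by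
  have h : HasDerivAt (fun t => ∑ σ : Equiv.Perm (Fin N),
      ((Equiv.Perm.sign σ : ℤ) : ℂ) * ∏ i, (A t)ᵀ (σ i) i)
      (∑ σ : Equiv.Perm (Fin N), ((Equiv.Perm.sign σ : ℤ) : ℂ) *
        ∑ i, (∏ j ∈ Finset.univ.erase i, (A t)ᵀ (σ j) j) • Bᵀ (σ i) i) t :=
    HasDerivAt.fun_sum fun σ _ => (HasDerivAt.fun_finsetProd fun i _ => hA i (σ i)).const_mul _
  have e1 : (fun t => (A t).det) = fun t => ∑ σ : Equiv.Perm (Fin N),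
      ((Equiv.Perm.sign σ : ℤ) : ℂ) * ∏ i, (A t)ᵀ (σ i) i := by
    funext t; rw [← det_transpose, det_apply']
  rw [e1]
  convert! h using 1
  simp only [Finset.mul_sum]
  rw [Finset.sum_comm]
  refine Finset.sum_congr rfl fun i _ => ?_
  rw [← det_transpose, det_apply']
  refine Finset.sum_congr rfl fun σ _ => ?_
  congr 1
  rw [← Finset.prod_erase_mul _ _ (Finset.mem_univ i)]
  simp only [transpose_apply, updateRow_self, smul_eq_mul]
  congr 1
  refine Finset.prod_congr rfl fun j hj => ?_
  rw [updateRow_ne (Finset.ne_of_mem_erase hj)]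

theorem rowDet_update {V : Type} {N : ℕ} {Φ : Fin N → V → V → ℂ} (i : Fin N) (L : V → V → ℂ) (v : Fin N → V) :
    rowDet (Function.update Φ i L) v
      = ((of fun a b => Φ a (v a) (v b)).updateRow i fun j => L (v i) (v j)).det := by
  rw [rowDet]
  congr 1
  ext a b
  by_cases h : a = i
  · subst h; simp
  · simp [h]

section Deformation

variable {V : Type} [MeasurableSpace V] {μ : Measure V} [SigmaFinite μ] {N : ℕ}
  {r s : V → ℝ} {C : ℝ} 

theorem isDominatedKernel_update {Φ : Fin N → V → V → ℂ} {L : V → V → ℂ}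
    (hΦ : ∀ i, IsDominatedKernel r s C (Φ i)) (hL : IsDominatedKernel r s C L) (i j : Fin N) :
    IsDominatedKernel r s C (Function.update Φ i L j) := by
  by_cases h : j = i
  · subst h; simpa using! hL
  · simpa [h] using! hΦ j

theorem hasDerivAt_rowDetIntegral (hr : ∀ v, 0 ≤ r v) (hs : ∀ v, 0 ≤ s v) (hC : 0 ≤ C)
    (hrs : Integrable (fun v => r v * s v) μ) {K L : V → V → ℂ}
    (hK : IsDominatedKernel r s C K) (hL : IsDominatedKernel r s C L) (t : ℝ) :
    HasDerivAt (fun t : ℝ => rowDetIntegral μ (fun _ : Fin N => fun v w => K v w + t * L v w))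
      (∑ i, rowDetIntegral μ
        (Function.update (fun _ : Fin N => fun v w => K v w + t * L v w) i L)) t := by
  set C₂ := C + (‖t‖ + 1) * C with hC₂
  have hC₂0 : 0 ≤ C₂ := by positivity
  have hKt : ∀ u ∈ Metric.ball t 1, IsDominatedKernel r s C₂ (fun v w => K v w + (u : ℂ) * L v w) := by
    intro u hu
    refine (hK.add (hL.const_mul u)).mono hr hs ?_
    rw [hC₂, Complex.norm_real]
    gcongr
    have := norm_sub_norm_le u t
    rw [mem_ball_iff_norm] at hu
    linarith
  have hLD : IsDominatedKernel r s C₂ L := hL.mono hr hs (by rw [hC₂]; nlinarith [norm_nonneg t])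
  have hD : ∀ u ∈ Metric.ball t 1, ∀ i j, IsDominatedKernel r s C₂
      (Function.update (fun _ : Fin N => fun v w => K v w + (u : ℂ) * L v w) i L j) :=
    fun u hu i j => isDominatedKernel_update (fun _ => hKt u hu) hLD i j
  have ht : t ∈ Metric.ball t 1 := Metric.mem_ball_self one_pos
  have := (hasDerivAt_integral_of_dominated_loc_of_deriv_le
    (μ := Measure.pi fun _ : Fin N => μ) (s := Metric.ball t 1)
    (F := fun (u : ℝ) v => rowDet (fun _ : Fin N => fun v w => K v w + (u : ℂ) * L v w) v)
    (F' := fun (u : ℝ) v => ∑ i, rowDet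
      (Function.update (fun _ : Fin N => fun v w => K v w + (u : ℂ) * L v w) i L) v)
    (bound := fun v => ∑ i : Fin N, √((N : ℝ) ^ N) * ∏ i, C₂ * (r (v i) * s (v i)))
    (x₀ := t) (Metric.ball_mem_nhds t one_pos) ?_ ?_ ?_ ?_ ?_ ?_).2
  · rwa [integral_finsetSum _ fun i _ => integrable_rowDet hr hs hC₂0 hrs (hD t ht i)] at this
  · filter_upwards [Metric.ball_mem_nhds t one_pos] with u hu
    exact (measurable_rowDet fun _ => hKt u hu).aestronglyMeasurable
  · exact integrable_rowDet hr hs hC₂0 hrs fun _ => hKt t ht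
  · exact (Finset.measurable_fun_sum _ fun i _ =>
      measurable_rowDet (hD t ht i)).aestronglyMeasurable
  · exact Eventually.of_forall fun v u hu => norm_sum_le_of_le _ fun i _ =>
      norm_rowDet_le hr hs hC₂0 (hD u hu i) v
  · exact integrable_finsetSum _ fun i _ => integrable_rowDet_bound hrs _ _
  · refine Eventually.of_forall fun v u _ => ?_
    simp only [rowDet_update]
    refine hasDerivAt_det_add_smul (fun u : ℝ => of fun a b => K (v a) (v b) + (u : ℂ) * L (v a) (v b))
      (of fun a b => L (v a) (v b)) u fun i j => ?_
    simpa using! ((Complex.ofRealCLM.hasDerivAt (x := u)).mul_const (L (v i) (v j))).const_add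
      (K (v i) (v j))

theorem rowDetIntegral_update_const (K L : V → V → ℂ) (i : Fin (N + 1)) :
    rowDetIntegral μ (Function.update (fun _ : Fin (N + 1) => K) i L)
      = rowDetIntegral μ (Fin.cons L (fun _ : Fin N => K) : Fin (N + 1) → V → V → ℂ) := by
  have hmp := measurePreserving_piCongrLeft (fun _ : Fin (N + 1) => μ) (Equiv.swap 0 i)
  unfold rowDetIntegral
  rw [← hmp.integral_comp']
  refine integral_congr_ae (Eventually.of_forall fun v => ?_)
  unfold rowDet
  dsimp only
  refine (det_submatrix_equiv_self (Equiv.swap 0 i) _).symm.trans (congrArg det ?_)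
  have hv : ∀ a, (MeasurableEquiv.piCongrLeft (fun _ => V) (Equiv.swap 0 i)) v (Equiv.swap 0 i a)
      = v a := fun a => MeasurableEquiv.piCongrLeft_apply_apply (β := fun _ => V) _ _ _
  ext a b
  simp only [submatrix_apply, of_apply, hv]
  refine Fin.cases ?_ (fun a => ?_) a
  · simp
  · have : Equiv.swap 0 i a.succ ≠ i := by
      intro h
      have h2 := congrArg (Equiv.swap 0 i) h
      simp at h2
    rw [Function.update_of_ne this, Fin.cons_succ]

theorem norm_fredholm_coeff (n : ℕ) : ‖(-1 : ℂ) ^ n / (n.factorial : ℂ)‖ = 1 / n.factorial := by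
  simp

theorem summable_fredholmDet (hr : ∀ v, 0 ≤ r v) (hs : ∀ v, 0 ≤ s v) (hC : 0 ≤ C)
    (hrs : Integrable (fun v => r v * s v) μ) {K : V → V → ℂ} (hK : IsDominatedKernel r s C K) :
    Summable fun m : ℕ => ((-1 : ℂ) ^ (m + 1) / (Nat.factorial (m + 1) : ℂ)) *
      rowDetIntegral μ (fun _ : Fin (m + 1) => K) := by
  have ha : 0 ≤ C * ∫ v, r v * s v ∂μ :=
    mul_nonneg hC (integral_nonneg fun v => mul_nonneg (hr v) (hs v))
  set a := C * ∫ v, r v * s v ∂μ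
  refine Summable.of_norm_bounded (g := fun m : ℕ =>
    √(Real.exp (16 * Real.exp 1 * a ^ 2)) * (1 / 2) ^ (m + 1)) ?_ fun m => ?_
  · exact ((summable_nat_add_iff 1).2 summable_geometric_two).mul_left _
  · refine le_trans ?_ (sqrt_pow_self_mul_pow_div_factorial_le a ha (m + 1))
    rw [norm_mul, norm_fredholm_coeff]
    calc _ ≤ 1 / ((m + 1).factorial : ℝ) * (√(((m + 1 : ℕ) : ℝ) ^ (m + 1)) * a ^ (m + 1)) := by
          gcongr
          exact norm_rowDetIntegral_le hr hs hC hrs fun _ => hK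
      _ = 1 * (√(((m + 1 : ℕ) : ℝ) ^ (m + 1)) * a ^ (m + 1) / (m + 1).factorial) := by ring
      _ ≤ _ := by
          gcongr
          simp

/-- The Fredholm determinant is unchanged when the square-zero, traceless part `F` of the kernel
`G + F` is replaced by the composition `G ∘ F`. -/
theorem fredholmDet_add_eq_add_kerComp (hr : ∀ v, 0 ≤ r v) (hs : ∀ v, 0 ≤ s v) (hC : 0 ≤ C)
    (hrs : Integrable (fun v => r v * s v) μ) {G F M : V → V → ℂ}
    (hG : IsDominatedKernel r s C G) (hF : IsDominatedKernel r s C F)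
    (hM : IsDominatedKernel r s C M) (hF0 : ∀ v, F v v = 0) (hGF : kerComp μ G F = M)
    (hMF : kerComp μ M F = 0) (hFF : kerComp μ F F = 0) :
    fredholmDet μ (fun v w => G v w + F v w) = fredholmDet μ (fun v w => G v w + M v w) := by
  set K : ℝ → V → V → ℂ := fun t v w => (G v w + F v w) + t * (M v w + (-1) * F v w) with hKdef
  have hK0 : K 0 = fun v w => G v w + F v w := by funext v w; simp [hKdef]
  have hK1 : K 1 = fun v w => G v w + M v w := by funext v w; simp [hKdef]; ring
  have hL : IsDominatedKernel r s (2 * C) (fun v w => M v w + (-1) * F v w) := by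
    convert! hM.add (hF.const_mul (-1)) using 1; simp; ring
  have hGF' : IsDominatedKernel r s (2 * C) (fun v w => G v w + F v w) := by
    convert! hG.add hF using 1; ring
  have hKt : ∀ t ∈ Set.Icc (0 : ℝ) 1, IsDominatedKernel r s (4 * C) (K t) := by
    intro t ht
    refine (hGF'.add (hL.const_mul t)).mono hr hs ?_
    rw [Complex.norm_real, Real.norm_of_nonneg ht.1]
    nlinarith [ht.1, ht.2]
  have hKF : ∀ t, kerComp μ (K t) F = M := by
    intro t
    funext v w
    have iG := hG.integrable_mul hF hrs v w
    have iF := hF.integrable_mul hF hrs v w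
    have iM := hM.integrable_mul hF hrs v w
    have e1 : ∫ u, G v u * F u w ∂μ = M v w := congrFun (congrFun hGF v) w
    have e2 : ∫ u, M v u * F u w ∂μ = 0 := congrFun (congrFun hMF v) w
    have e3 : ∫ u, F v u * F u w ∂μ = 0 := congrFun (congrFun hFF v) w
    have : ∀ u, K t v u * F u w
        = G v u * F u w + ((1 - t) * (F v u * F u w) + t * (M v u * F u w)) := by
      intro u; simp only [hKdef]; ring
    unfold kerComp
    simp only [this]
    have i2 : Integrable (fun u => (1 - t : ℂ) * (F v u * F u w) + t * (M v u * F u w)) μ :=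
      (iF.const_mul _).add (iM.const_mul _)
    rw [integral_add iG i2, integral_add (iF.const_mul _) (iM.const_mul _), integral_const_mul,
      integral_const_mul, e1, e2, e3]
    simp
  have hC4 : 0 ≤ 4 * C := by positivity
  have hF4 := hF.mono hr hs (show C ≤ 4 * C by linarith)
  have hM4 := hM.mono hr hs (show C ≤ 4 * C by linarith)
  have hL4 := hL.mono hr hs (show 2 * C ≤ 4 * C by linarith)
  have hGF4 := hGF'.mono hr hs (show 2 * C ≤ 4 * C by linarith)
  set c : ℕ → ℂ := fun n => (-1 : ℂ) ^ n / (n.factorial : ℂ) with hc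
  set S : ℕ → ℝ → ℂ := fun n t =>
    ∑ i : Fin n, rowDetIntegral μ (Function.update (fun _ : Fin n => K t) i M) with hS
  have hderiv : ∀ n : ℕ, ∀ t ∈ Set.Icc (0 : ℝ) 1,
      HasDerivAt (fun t => c (n + 1) * rowDetIntegral μ (fun _ : Fin (n + 1) => K t))
      (c (n + 1) * S (n + 1) t - c n * S n t) t := by
    intro n t ht
    have h1 := (hasDerivAt_rowDetIntegral (N := n + 1) hr hs hC4 hrs hGF4 hL4 t).const_mul (c (n + 1))
    convert! h1 using 1
    have hsplit : ∀ i : Fin (n + 1), rowDetIntegral μ (Function.update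
        (fun _ : Fin (n + 1) => K t) i (fun v w => M v w + (-1) * F v w))
        = rowDetIntegral μ (Function.update (fun _ : Fin (n + 1) => K t) i M) + S n t := by
      intro i
      have hF' : rowDetIntegral μ (Function.update (fun _ : Fin (n + 1) => K t) i F) = - S n t := by
        rw [rowDetIntegral_update_const, rowDetIntegral_cons hr hs hC4 hrs hF4
          (fun _ => hKt t ht) hF0]
        simp only [hKF, hS]
      rw [← sub_neg_eq_add _ (S n t), ← hF']
      unfold rowDetIntegral
      rw [← integral_sub]
      · refine integral_congr_ae (Eventually.of_forall fun v => ?_)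
        simp only [rowDet_update, det_updateRow_eq_sum]
        rw [← Finset.sum_sub_distrib]
        exact Finset.sum_congr rfl fun j _ => by ring
      · exact integrable_rowDet hr hs hC4 hrs
          (isDominatedKernel_update (fun _ => hKt t ht) hM4 i)
      · exact integrable_rowDet hr hs hC4 hrs
          (isDominatedKernel_update (fun _ => hKt t ht) hF4 i)
    have hcn : c (n + 1) * (n + 1) = - c n := by
      simp only [hc, Nat.factorial_succ]
      have : (n : ℂ) + 1 ≠ 0 := by exact_mod_cast n.succ_ne_zero
      have : (n.factorial : ℂ) ≠ 0 := by exact_mod_cast n.factorial_ne_zero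
      push_cast
      field_simp
      ring
    change _ = c (n + 1) * ∑ i, rowDetIntegral μ (Function.update
        (fun _ : Fin (n + 1) => K t) i (fun v w => M v w + (-1) * F v w))
    simp only [hsplit, Finset.sum_add_distrib, Finset.sum_const, Finset.card_univ,
      Fintype.card_fin, nsmul_eq_mul]
    have : c (n + 1) * ((n + 1 : ℕ) * S n t) = - c n * S n t := by
      rw [← mul_assoc]; push_cast; rw [hcn]
    rw [mul_add, this]
    simp only [hS]
    ring
  have hsumderiv : ∀ n : ℕ, ∀ t ∈ Set.Icc (0 : ℝ) 1, HasDerivAt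
      (fun t => ∑ m ∈ Finset.range n, c (m + 1) * rowDetIntegral μ (fun _ : Fin (m + 1) => K t))
      (c n * S n t) t := by
    intro n t ht
    convert! HasDerivAt.fun_sum (u := Finset.range n) fun m _ => hderiv m t ht using 1
    rw [Finset.sum_range_sub (fun m => c m * S m t)]
    simp [hS]
  set a := 4 * C * ∫ v, r v * s v ∂μ with ha_def
  have ha : 0 ≤ a := mul_nonneg hC4 (integral_nonneg fun v => mul_nonneg (hr v) (hs v))
  have hbound : ∀ n : ℕ, ∀ t ∈ Set.Icc (0 : ℝ) 1,
      ‖c n * S n t‖ ≤ √(Real.exp (16 * Real.exp 1 * a ^ 2)) * (1 / 2) ^ n := by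
    intro n t ht
    refine le_trans ?_ (sqrt_pow_self_mul_pow_div_factorial_le a ha n)
    rw [norm_mul, norm_fredholm_coeff]
    have : ‖S n t‖ ≤ ∑ i : Fin n, √((n : ℝ) ^ n) * a ^ n :=
      norm_sum_le_of_le _ fun i _ => norm_rowDetIntegral_le hr hs hC4 hrs
        (isDominatedKernel_update (fun _ => hKt t ht) hM4 i)
    simp only [Finset.sum_const, Finset.card_univ, Fintype.card_fin, nsmul_eq_mul] at this
    calc _ ≤ 1 / (n.factorial : ℝ) * (n * (√((n : ℝ) ^ n) * a ^ n)) := by gcongr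
      _ = _ := by ring
  have hdiff : ∀ n : ℕ, ‖(∑ m ∈ Finset.range n,
        c (m + 1) * rowDetIntegral μ (fun _ : Fin (m + 1) => K 1))
      - ∑ m ∈ Finset.range n, c (m + 1) * rowDetIntegral μ (fun _ : Fin (m + 1) => K 0)‖
      ≤ √(Real.exp (16 * Real.exp 1 * a ^ 2)) * (1 / 2) ^ n := fun n =>
    norm_image_sub_le_of_norm_deriv_le_segment_01'
      (fun t ht => (hsumderiv n t ht).hasDerivWithinAt)
      (fun t ht => hbound n t ⟨ht.1, ht.2.le⟩)
  have hsum : ∀ t ∈ Set.Icc (0 : ℝ) 1, Tendsto (fun n => ∑ m ∈ Finset.range n,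
      c (m + 1) * rowDetIntegral μ (fun _ : Fin (m + 1) => K t)) atTop
      (𝓝 (∑' m, c (m + 1) * rowDetIntegral μ (fun _ : Fin (m + 1) => K t))) := fun t ht =>
    (summable_fredholmDet hr hs hC4 hrs (hKt t ht)).hasSum.tendsto_sum_nat
  have hlim : Tendsto (fun n : ℕ => √(Real.exp (16 * Real.exp 1 * a ^ 2)) * (1 / 2 : ℝ) ^ n)
      atTop (𝓝 0) := by
    simpa using (tendsto_pow_atTop_nhds_zero_of_lt_one (by norm_num : (0 : ℝ) ≤ 1 / 2)
      (by norm_num)).const_mul (√(Real.exp (16 * Real.exp 1 * a ^ 2)))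
  have h0 := squeeze_zero_norm hdiff hlim
  have h1 := tendsto_nhds_unique ((hsum 1 (by simp)).sub (hsum 0 (by simp))) h0
  rw [← hK0, ← hK1]
  exact congrArg (1 + ·) (sub_eq_zero.1 h1).symm

end Deformation

section Andreief

variable {Z V : Type} [MeasurableSpace Z] [MeasurableSpace V] {ν : Measure Z} {ρ : Measure V}
  [SigmaFinite ν] [SigmaFinite ρ]

/-- A determinant is integrated row by row. -/
theorem integral_det_of_row {N : ℕ} {R : Fin N → V → Fin N → ℂ}
    (hR : ∀ i j, Integrable (fun v => R i v j) ρ) :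
    ∫ v : Fin N → V, (of fun i j => R i (v i) j).det ∂(Measure.pi fun _ => ρ)
      = (of fun i j => ∫ v, R i v j ∂ρ).det := by
  have hdet : ∀ A : Matrix (Fin N) (Fin N) ℂ, A.det
      = ∑ σ : Equiv.Perm (Fin N), ((Equiv.Perm.sign σ : ℤ) : ℂ) * ∏ i, A i (σ i) := by
    intro A; rw [← det_transpose, det_apply']; rfl
  simp only [hdet, of_apply]
  rw [integral_finsetSum _ fun σ _ => (Integrable.fintype_prod
    (f := fun i v => R i v (σ i)) fun i => hR i (σ i)).const_mul _]
  refine Finset.sum_congr rfl fun σ _ => ?_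
  rw [integral_const_mul, integral_fintype_prod_eq_prod (fun i v => R i v (σ i))]

variable {r s : V → ℝ} {β : Z → ℝ} {C C' : ℝ} {A : Z → V → ℂ} {B : V → Z → ℂ}

/-- Andréief's identity for the traces of exterior powers of the two compositions of a pair of
kernels. -/
theorem rowDetIntegral_kerComp_comm {N : ℕ} (hr : ∀ v, 0 ≤ r v) (hβ : ∀ z, 0 ≤ β z) (hC : 0 ≤ C')
    (hrs : Integrable (fun v => r v * s v) ρ) (hββ : Integrable (fun z => β z * β z) ν)
    (hA : IsDominatedKernel β s C A) (hB : IsDominatedKernel r β C' B) :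
    rowDetIntegral ρ (fun _ : Fin N => kerComp ν B A)
      = rowDetIntegral ν (fun _ : Fin N => kerComp ρ A B) := by
  have hJ : Integrable (Function.uncurry fun (v : Fin N → V) (z : Fin N → Z) =>
      (∏ i, A (z i) (v i)) * (of fun i j => B (v i) (z j)).det)
      ((Measure.pi fun _ => ρ).prod (Measure.pi fun _ => ν)) := by
    have h1 : Integrable (fun p : (Fin N → V) × (Fin N → Z) =>
        (∏ i, r (p.1 i) * s (p.1 i)) * (∏ i, β (p.2 i) * β (p.2 i)))
        ((Measure.pi fun _ => ρ).prod (Measure.pi fun _ => ν)) :=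
      (Integrable.fintype_prod (f := fun _ : Fin N => fun v => r v * s v) fun _ => hrs).mul_prod
        (Integrable.fintype_prod (f := fun _ : Fin N => fun z => β z * β z) fun _ => hββ)
    refine (h1.const_mul (√((N : ℝ) ^ N) * (C ^ N * C' ^ N))).mono' ?_
      (Eventually.of_forall fun p => ?_)
    · refine Measurable.aestronglyMeasurable (Measurable.mul ?_ ?_)
      · exact Finset.measurable_fun_prod _ fun i _ =>
          hA.measurable_apply (by fun_prop) (by fun_prop)
      · simp only [det_apply, of_apply]
        refine Finset.measurable_fun_sum _ fun σ _ => Measurable.const_smul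
          (Finset.measurable_fun_prod _ fun i _ => ?_) _
        exact hB.measurable_apply (by fun_prop) (by fun_prop)
    · obtain ⟨v, z⟩ := p
      have h2 := norm_det_le_of_norm_entry_le_mul (of fun i j => B (v i) (z j))
        (fun i => C' * r (v i)) (fun i => β (z i)) (fun i => mul_nonneg hC (hr _))
        (fun i => hβ _) (fun i j => by simpa only [mul_assoc] using! hB.bound (v i) (z j))
      have h3 : ‖∏ i, A (z i) (v i)‖ ≤ ∏ i, C * (β (z i) * s (v i)) := by
        rw [norm_prod]
        exact Finset.prod_le_prod (fun i _ => norm_nonneg _) fun i _ => hA.bound _ _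
      rw [Function.uncurry_apply_pair, norm_mul]
      refine (mul_le_mul h3 h2 (norm_nonneg _) ((norm_nonneg _).trans h3)).trans_eq ?_
      simp only [Finset.prod_mul_distrib, Finset.prod_const, Finset.card_univ, Fintype.card_fin]
      ring
  have hswap := integral_integral_swap hJ
  have e1 : ∀ v : Fin N → V, ∫ z : Fin N → Z, (∏ i, A (z i) (v i)) *
      (of fun i j => B (v i) (z j)).det ∂(Measure.pi fun _ => ν)
      = rowDet (fun _ : Fin N => kerComp ν B A) v := by
    intro v
    have : ∀ z : Fin N → Z, (∏ i, A (z i) (v i)) * (of fun i j => B (v i) (z j)).det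
        = (of fun j i => B (v i) (z j) * A (z j) (v j)).det := by
      intro z
      rw [← det_mul_row, ← det_transpose]
      congr 1
      ext i j
      simp [mul_comm]
    simp only [this]
    rw [integral_det_of_row (R := fun j z i => B (v i) z * A z (v j))
      fun j i => hB.integrable_mul hA hββ (v i) (v j), ← det_transpose]
    rfl
  have e2 : ∀ z : Fin N → Z, ∫ v : Fin N → V, (∏ i, A (z i) (v i)) *
      (of fun i j => B (v i) (z j)).det ∂(Measure.pi fun _ => ρ)
      = rowDet (fun _ : Fin N => kerComp ρ A B) z := by
    intro z
    have : ∀ v : Fin N → V, (∏ i, A (z i) (v i)) * (of fun i j => B (v i) (z j)).det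
        = (of fun i j => A (z i) (v i) * B (v i) (z j)).det := by
      intro v
      rw [← det_mul_column]
      rfl
    simp only [this]
    rw [integral_det_of_row (R := fun i v j => A (z i) v * B v (z j))
      fun i j => hA.integrable_mul hB hrs (z i) (z j)]
    rfl
  simp only [e1, e2] at hswap
  exact hswap

theorem fredholmDet_kerComp_comm (hr : ∀ v, 0 ≤ r v) (hβ : ∀ z, 0 ≤ β z) (hC : 0 ≤ C')
    (hrs : Integrable (fun v => r v * s v) ρ) (hββ : Integrable (fun z => β z * β z) ν)
    (hA : IsDominatedKernel β s C A) (hB : IsDominatedKernel r β C' B) :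
    fredholmDet ρ (kerComp ν B A) = fredholmDet ν (kerComp ρ A B) := by
  unfold fredholmDet
  congr 1
  refine tsum_congr fun m => ?_
  congr 1
  exact rowDetIntegral_kerComp_comm (N := m + 1) hr hβ hC hrs hββ hA hB

end Andreief

theorem kerComp_assoc {W X Y Z : Type} [MeasurableSpace W] [MeasurableSpace X] [MeasurableSpace Y]
    [MeasurableSpace Z] {μ : Measure X} {ν : Measure Y} [SFinite μ] [SFinite ν]
    {r₁ : W → ℝ} {s₁ r₂ : X → ℝ} {s₂ r₃ : Y → ℝ} {s₃ : Z → ℝ} {C₁ C₂ C₃ : ℝ}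
    {K : W → X → ℂ} {L : X → Y → ℂ} {M : Y → Z → ℂ}
    (hK : IsDominatedKernel r₁ s₁ C₁ K) (hL : IsDominatedKernel r₂ s₂ C₂ L)
    (hM : IsDominatedKernel r₃ s₃ C₃ M) (h₁ : Integrable (fun x => r₂ x * s₁ x) μ)
    (h₂ : Integrable (fun y => r₃ y * s₂ y) ν) :
    kerComp ν (kerComp μ K L) M = kerComp μ K (kerComp ν L M) := by
  funext w z
  unfold kerComp
  simp only [← integral_const_mul, ← integral_mul_const]
  have hJ : Integrable (Function.uncurry fun (x : X) (y : Y) => K w x * (L x y * M y z))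
      (μ.prod ν) := by
    refine ((h₁.mul_prod h₂).const_mul (C₁ * C₂ * C₃ * r₁ w * s₃ z)).mono' ?_
      (Eventually.of_forall fun p => ?_)
    · exact ((hK.measurable_apply (by fun_prop) (by fun_prop)).mul
        ((hL.measurable_apply (by fun_prop) (by fun_prop)).mul
        (hM.measurable_apply (by fun_prop) (by fun_prop)))).aestronglyMeasurable
    · obtain ⟨x, y⟩ := p
      rw [Function.uncurry_apply_pair, norm_mul, norm_mul]
      have b1 := hK.bound w x
      have b2 := hL.bound x y
      have b3 := hM.bound y z
      refine (mul_le_mul b1 (mul_le_mul b2 b3 (norm_nonneg _) ((norm_nonneg _).trans b2))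
        (by positivity) ((norm_nonneg _).trans b1)).trans_eq ?_
      ring
  simp only [mul_assoc]
  exact (integral_integral_swap hJ).symm

/-- A kernel `B ∘ Q + F` with `F` traceless and square-zero has the same Fredholm determinant as
the kernel `Q ∘ B + (Q ∘ F) ∘ B` on the intermediate space. -/
theorem fredholmDet_kerComp_add {Z V : Type} [MeasurableSpace Z] [MeasurableSpace V]
    {ν : Measure Z} {ρ : Measure V} [SigmaFinite ν] [SigmaFinite ρ]
    {r s : V → ℝ} {β : Z → ℝ} {C : ℝ} {Q : Z → V → ℂ} {B : V → Z → ℂ} {F : V → V → ℂ}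
    (hr : ∀ v, 0 ≤ r v) (hs : ∀ v, 0 ≤ s v) (hβ : ∀ z, 0 ≤ β z) (hC : 0 ≤ C)
    (hrs : Integrable (fun v => r v * s v) ρ) (hββ : Integrable (fun z => β z * β z) ν)
    (hQ : IsDominatedKernel β s C Q) (hB : IsDominatedKernel r β C B)
    (hF : IsDominatedKernel r s C F) (hF0 : ∀ v, F v v = 0) (hFF : kerComp ρ F F = 0) :
    fredholmDet ρ (fun v w => kerComp ν B Q v w + F v w)
      = fredholmDet ν (fun z w => kerComp ρ Q B z w + kerComp ρ (kerComp ρ Q F) B z w) := by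
  have hQF := hQ.kerComp hF hrs
  have hG := hB.kerComp hQ hββ
  have hM := hB.kerComp hQF hββ
  have hGF : kerComp ρ (kerComp ν B Q) F = kerComp ν B (kerComp ρ Q F) :=
    kerComp_assoc hB hQ hF hββ hrs
  have hMF : kerComp ρ (kerComp ν B (kerComp ρ Q F)) F = 0 := by
    rw [← hGF, kerComp_assoc hG hF hF hrs hrs, hFF]
    funext v w
    simp [kerComp]
  have hrs0 : 0 ≤ ∫ v, r v * s v ∂ρ := integral_nonneg fun v => mul_nonneg (hr v) (hs v)
  have hββ0 : 0 ≤ ∫ z, β z * β z ∂ν := integral_nonneg fun z => mul_nonneg (hβ z) (hβ z)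
  set I := ∫ v, r v * s v ∂ρ
  set I' := ∫ z, β z * β z ∂ν
  set D := C + C * C * I' + C * (C * C * I) * I' with hD
  have d1 : 0 ≤ C * C * I' := by positivity
  have d2 : 0 ≤ C * (C * C * I) * I' := by positivity
  rw [fredholmDet_add_eq_add_kerComp hr hs (by positivity : 0 ≤ D) hrs
    (hG.mono hr hs (by linarith)) (hF.mono hr hs (by linarith)) (hM.mono hr hs (by linarith))
    hF0 hGF hMF hFF]
  have e1 : (fun v w => kerComp ν B Q v w + kerComp ν B (kerComp ρ Q F) v w)
      = kerComp ν B (fun z w => Q z w + kerComp ρ Q F z w) := by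
    funext v w
    have := integral_add (hB.integrable_mul hQ hββ v w) (hB.integrable_mul hQF hββ v w)
    simp only [← mul_add] at this
    exact this.symm
  have e2 : (fun z w => kerComp ρ Q B z w + kerComp ρ (kerComp ρ Q F) B z w)
      = kerComp ρ (fun z w => Q z w + kerComp ρ Q F z w) B := by
    funext z w
    have := integral_add (hQ.integrable_mul hB hrs z w) (hQF.integrable_mul hB hrs z w)
    simp only [← add_mul] at this
    exact this.symm
  rw [e1, e2]
  exact fredholmDet_kerComp_comm hr hβ hC hrs hββ (hQ.add hQF) hB

theorem quasiMeasurePreserving_pi_pair {V : Type} [MeasurableSpace V] (μ : Measure V)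
    [SigmaFinite μ] {N : ℕ} {i j : Fin N} (hij : i ≠ j) :
    Measure.QuasiMeasurePreserving (fun v : Fin N → V => (v i, v j))
      (Measure.pi fun _ => μ) (μ.prod μ) := by
  obtain _ | N := N
  · exact i.elim0
  obtain ⟨j, rfl⟩ := Fin.exists_succAbove_eq hij.symm
  exact (QuasiMeasurePreserving.prodMap (Measure.QuasiMeasurePreserving.id μ)
    (Measure.quasiMeasurePreserving_eval (fun _ : Fin N => μ) j)).comp
    (measurePreserving_piFinSuccAbove (fun _ : Fin (N + 1) => μ) i).quasiMeasurePreserving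

theorem fredholmDet_congr_ae {V : Type} [MeasurableSpace V] {μ : Measure V} [SigmaFinite μ]
    {K L : V → V → ℂ} (hdiag : ∀ v, K v v = L v v)
    (h : ∀ᵐ p ∂(μ.prod μ), K p.1 p.2 = L p.1 p.2) : fredholmDet μ K = fredholmDet μ L := by
  unfold fredholmDet
  congr 1
  refine tsum_congr fun m => ?_
  congr 1
  refine integral_congr_ae ?_
  have : ∀ i j : Fin (m + 1), ∀ᵐ v ∂(Measure.pi fun _ : Fin (m + 1) => μ),
      K (v i) (v j) = L (v i) (v j) := by
    intro i j
    by_cases hij : i = j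
    · exact Eventually.of_forall fun v => by rw [hij, hdiag]
    · exact (quasiMeasurePreserving_pi_pair μ hij).ae h
  filter_upwards [ae_all_iff.2 fun i => ae_all_iff.2 fun j => this i j] with v hv
  simp only [hv]

theorem fredholmDet_comp_measurableEquiv {V W : Type} [MeasurableSpace V] [MeasurableSpace W]
    {μ : Measure V} {ν : Measure W} [SigmaFinite μ] [SigmaFinite ν] (e : V ≃ᵐ W)
    (he : MeasurePreserving e μ ν) (K : W → W → ℂ) :
    fredholmDet ν K = fredholmDet μ fun v w => K (e v) (e w) := by
  unfold fredholmDet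
  congr 1
  refine tsum_congr fun m => ?_
  congr 1
  have hmp := measurePreserving_pi (fun _ : Fin (m + 1) => μ) (fun _ : Fin (m + 1) => ν)
    (f := fun _ => e) (fun _ => he)
  exact (hmp.integral_comp (MeasurableEquiv.piCongrRight
    fun _ : Fin (m + 1) => e).measurableEmbedding _).symm

section FiniteTimesLine

variable {ι κ : Type} [Fintype ι] [MeasurableSpace ι] [MeasurableSingletonClass ι]
  [Fintype κ] [MeasurableSpace κ] [MeasurableSingletonClass κ]

theorem integrable_count_prod {E : Type} [NormedAddCommGroup E] [NormedSpace ℝ E]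
    {f : ι × ℝ → E} (hm : AEStronglyMeasurable f ((Measure.count : Measure ι).prod volume))
    (hf : ∀ i, Integrable fun t => f (i, t)) :
    Integrable f ((Measure.count : Measure ι).prod volume) :=
  (integrable_prod_iff hm).2 ⟨Eventually.of_forall hf, Integrable.of_finite⟩

theorem integral_count_prod {f : ι × ℝ → ℂ}
    (hf : Integrable f ((Measure.count : Measure ι).prod volume)) :
    ∫ p, f p ∂((Measure.count : Measure ι).prod volume) = ∑ i, ∫ t, f (i, t) := by
  rw [integral_prod _ hf, integral_count]

theorem measurable_uncurry_of_slices {K : ι × ℝ → κ × ℝ → ℂ}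
    (h : ∀ i j, Measurable fun p : ℝ × ℝ => K (i, p.1) (j, p.2)) :
    Measurable (Function.uncurry K) := by
  have h1 : Measurable fun q : (ι × κ) × (ℝ × ℝ) => K (q.1.1, q.2.1) (q.1.2, q.2.2) :=
    measurable_from_prod_countable_right fun ij => h ij.1 ij.2
  exact h1.comp (f := fun q : (ι × ℝ) × (κ × ℝ) => ((q.1.1, q.2.1), (q.1.2, q.2.2)))
    (by fun_prop)

theorem exists_isDominatedKernel_of_slices {r : ι × ℝ → ℝ} {s : κ × ℝ → ℝ} (hr : ∀ v, 0 ≤ r v)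
    (hs : ∀ v, 0 ≤ s v) {K : ι × ℝ → κ × ℝ → ℂ}
    (h : ∀ i j, Measurable fun p : ℝ × ℝ => K (i, p.1) (j, p.2))
    (hb : ∀ i j, ∃ C : ℝ, ∀ t u, ‖K (i, t) (j, u)‖ ≤ C * (r (i, t) * s (j, u))) :
    ∃ C : ℝ, 0 ≤ C ∧ IsDominatedKernel r s C K := by
  choose C hC using hb
  refine ⟨∑ i, ∑ j, |C i j|, by positivity, measurable_uncurry_of_slices h, ?_⟩
  rintro ⟨i, t⟩ ⟨j, u⟩
  refine (hC i j t u).trans (mul_le_mul_of_nonneg_right ((le_abs_self _).trans ?_)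
    (mul_nonneg (hr _) (hs _)))
  exact (Finset.single_le_sum (f := fun j => |C i j|) (fun _ _ => abs_nonneg _)
    (Finset.mem_univ j)).trans (Finset.single_le_sum (f := fun i => ∑ j, |C i j|)
      (fun _ _ => Finset.sum_nonneg fun _ _ => abs_nonneg _) (Finset.mem_univ i))

end FiniteTimesLine

theorem ae_abs_ne_abs {ι : Type} [Fintype ι] [MeasurableSpace ι] :
    ∀ᵐ p : (ι × ℝ) × (ι × ℝ) ∂(((Measure.count : Measure ι).prod volume).prod
      ((Measure.count : Measure ι).prod volume)),
      p.1.2 ≠ 0 ∧ p.2.2 ≠ 0 ∧ |p.1.2| ≠ |p.2.2| := by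
  have h1 : ∀ᵐ p : ℝ × ℝ, p.1 ≠ 0 ∧ p.2 ≠ 0 ∧ |p.1| ≠ |p.2| := by
    have h0 : ∀ x : ℝ, ∀ᵐ y : ℝ, y ≠ x := fun x => Measure.ae_ne volume x
    have hm : MeasurableSet {p : ℝ × ℝ | p.1 ≠ 0 ∧ p.2 ≠ 0 ∧ |p.1| ≠ |p.2|} := by
      have e1 : MeasurableSet {p : ℝ × ℝ | p.1 = 0} := measurableSet_eq_fun (by fun_prop) (by fun_prop)
      have e2 : MeasurableSet {p : ℝ × ℝ | p.2 = 0} := measurableSet_eq_fun (by fun_prop) (by fun_prop)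
      have e3 : MeasurableSet {p : ℝ × ℝ | |p.1| = |p.2|} :=
        measurableSet_eq_fun (by fun_prop) (by fun_prop)
      exact e1.compl.inter (e2.compl.inter e3.compl)
    refine (Measure.ae_prod_mem_iff_ae_ae_mem hm).2 ?_
    filter_upwards [h0 0] with x hx
    filter_upwards [h0 0, h0 x, h0 (-x)] with y hy hyx hyx'
    refine ⟨hx, hy, fun h => ?_⟩
    rcases abs_eq_abs.1 h with h | h
    · exact hyx h.symm
    · exact hyx' (by rw [h, neg_neg])
  exact (QuasiMeasurePreserving.prodMap (Measure.quasiMeasurePreserving_snd (μ := Measure.count))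
    (Measure.quasiMeasurePreserving_snd (μ := Measure.count))).ae h1

theorem sum_fin_two_mul {k : ℕ} (f : Fin (2 * k) → ℂ) :
    ∑ s, f s = ∑ l : Fin k, (f ⟨2 * l, by omega⟩ + f ⟨2 * l + 1, by omega⟩) := by
  let g : ℕ → ℂ := fun s => if h : s < 2 * k then f ⟨s, h⟩ else 0
  have h1 : ∀ m : ℕ, ∑ s ∈ Finset.range (2 * m), g s
      = ∑ l ∈ Finset.range m, (g (2 * l) + g (2 * l + 1)) := by
    intro m
    induction m with
    | zero => simp
    | succ m ih =>
      rw [show 2 * (m + 1) = 2 * m + 1 + 1 by ring, Finset.sum_range_succ, Finset.sum_range_succ,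
        ih, Finset.sum_range_succ]
      ring
  have h2 := h1 k
  rw [Finset.sum_range, Finset.sum_range] at h2
  refine (Finset.sum_congr rfl fun s _ => ?_).trans (h2.trans (Finset.sum_congr rfl fun l _ => ?_))
  · simp [g]
  · have e1 : 2 * (l : ℕ) < 2 * k := by omega
    have e2 : 2 * (l : ℕ) + 1 < 2 * k := by omega
    simp [g, e1, e2]

theorem multiInterval_two_mul {k : ℕ} (a : Fin (2 * k) → ℝ) :
    multiInterval a
      = ⋃ l : Fin k, Set.Icc (a ⟨2 * l, by omega⟩) (a ⟨2 * l + 1, by omega⟩) := by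
  ext x
  simp only [multiInterval, Set.mem_iUnion]
  constructor
  · rintro ⟨m, hm, hx⟩
    have h : (m : ℕ) + 1 < 2 * k := by omega
    rw [dif_pos h] at hx
    refine ⟨⟨(m : ℕ) / 2, by omega⟩, ?_⟩
    have e : 2 * ((m : ℕ) / 2) = m := by omega
    convert hx using 3 <;> simp [e]
  · rintro ⟨l, hx⟩
    refine ⟨⟨2 * l, by omega⟩, by simp, ?_⟩
    have h : 2 * (l : ℕ) + 1 < 2 * k := by omega
    rw [dif_pos h]
    exact hx

theorem measurableSet_multiInterval {k : ℕ} (a : Fin (2 * k) → ℝ) :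
    MeasurableSet (multiInterval a) := by
  rw [multiInterval_two_mul]
  exact MeasurableSet.iUnion fun _ => measurableSet_Icc

theorem isCompact_multiInterval {k : ℕ} (a : Fin (2 * k) → ℝ) :
    IsCompact (multiInterval a) := by
  rw [multiInterval_two_mul]
  exact isCompact_iUnion fun _ => isCompact_Icc

theorem integral_multiInterval_exp {k : ℕ} {a : Fin (2 * k) → ℝ} (ha : StrictMono a) {ξ : ℂ}
    (hξ : ξ ≠ 0) :
    ∫ x in multiInterval a, Complex.exp (x * ξ)
      = -(∑ s : Fin (2 * k), (-1) ^ (s : ℕ) * Complex.exp (a s * ξ)) / ξ := by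
  have hcont : Continuous fun x : ℝ => Complex.exp (x * ξ) := by fun_prop
  rw [multiInterval_two_mul, integral_iUnion_fintype (fun _ => measurableSet_Icc) ?_
    (fun _ => hcont.integrableOn_Icc), sum_fin_two_mul, neg_div, Finset.sum_div,
    ← Finset.sum_neg_distrib]
  · refine Finset.sum_congr rfl fun l _ => ?_
    have hle : a ⟨2 * l, by omega⟩ ≤ a ⟨2 * l + 1, by omega⟩ := ha.monotone (by simp)
    rw [integral_Icc_eq_integral_Ioc, ← intervalIntegral.integral_of_le hle]
    have : ∀ x : ℝ, (x : ℂ) * ξ = ξ * x := fun x => mul_comm _ _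
    simp only [this]
    rw [integral_exp_mul_complex hξ]
    simp only [pow_mul, pow_succ]
    norm_num
    field_simp
    ring
  · have key : ∀ l m : Fin k, l < m → Disjoint
        (Set.Icc (a ⟨2 * l, by omega⟩) (a ⟨2 * l + 1, by omega⟩))
        (Set.Icc (a ⟨2 * m, by omega⟩) (a ⟨2 * m + 1, by omega⟩)) := by
      intro l m hlm
      have : a ⟨2 * l + 1, by omega⟩ < a ⟨2 * m, by omega⟩ := ha (by
        rw [Fin.mk_lt_mk]; have : (l : ℕ) < m := hlm; omega)
      rw [Set.disjoint_left]
      intro x hx hx'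
      linarith [hx.2, hx'.1]
    intro l m hlm
    rcases lt_or_gt_of_ne hlm with h | h
    · exact key l m h
    · exact (key m l h).symm

instance : MeasurableSpace (Option Bool) := ⊤

instance : DiscreteMeasurableSpace (Option Bool) := ⟨fun _ => trivial⟩

/-- The Pearcey contour with `n` channels as a disjoint union of finitely many lines; the tag
`none` labels `iℝ` and `some b` labels `γ_L`, `γ_R`. -/
def pearceyContourEquiv (n : ℕ) : ((Option Bool × Fin n) × ℝ) ≃ᵐ pDom × Fin n where
  toFun v := match v with
    | ((none, i), t) => (Sum.inl t, i)
    | ((some b, i), t) => (Sum.inr (b, t), i)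
  invFun w := match w with
    | (Sum.inl t, i) => ((none, i), t)
    | (Sum.inr (b, t), i) => ((some b, i), t)
  left_inv := by rintro ⟨⟨_ | b, i⟩, t⟩ <;> rfl
  right_inv := by rintro ⟨t | ⟨b, t⟩, i⟩ <;> rfl
  measurable_toFun := by
    refine measurable_from_prod_countable_right ?_
    rintro ⟨_ | b, i⟩
    · exact measurable_inl.prodMk measurable_const
    · exact (measurable_inr.comp (measurable_const.prodMk measurable_id)).prodMk measurable_const
  measurable_invFun := by
    refine measurable_from_prod_countable_left fun i => measurable_fun_sum ?_ ?_
    · exact (measurable_const (a := ((none : Option Bool), i))).prodMk measurable_id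
    · refine measurable_from_prod_countable_right fun b => ?_
      exact (measurable_const (a := (some b, i))).prodMk measurable_id

@[simp] theorem pearceyContourEquiv_none (n : ℕ) (i : Fin n) (t : ℝ) :
    pearceyContourEquiv n ((none, i), t) = (Sum.inl t, i) := rfl

@[simp] theorem pearceyContourEquiv_some (n : ℕ) (b : Bool) (i : Fin n) (t : ℝ) :
    pearceyContourEquiv n ((some b, i), t) = (Sum.inr (b, t), i) := rfl

instance : SFinite pDomMeasure := by
  unfold pDomMeasure
  infer_instance

theorem measurePreserving_pearceyContourEquiv (n : ℕ) :
    MeasurePreserving (pearceyContourEquiv n)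
      ((Measure.count : Measure (Option Bool × Fin n)).prod volume) (pVMeasure n) := by
  refine ⟨(pearceyContourEquiv n).measurable, Measure.ext fun s hs => ?_⟩
  rw [Measure.map_apply (pearceyContourEquiv n).measurable hs,
    Measure.prod_apply ((pearceyContourEquiv n).measurable hs), lintegral_count, tsum_fintype,
    Fintype.sum_prod_type, Fintype.sum_option, pVMeasure, Measure.prod_apply_symm hs,
    lintegral_count, tsum_fintype]
  have hi : ∀ i : Fin n, MeasurableSet ((fun x : pDom => (x, i)) ⁻¹' s) :=
    fun i => (measurable_id.prodMk measurable_const) hs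
  have : ∀ i : Fin n, pDomMeasure ((fun x : pDom => (x, i)) ⁻¹' s)
      = volume ((fun t : ℝ => ((Sum.inl t : pDom), i)) ⁻¹' s)
        + ∑ b : Bool, volume ((fun t : ℝ => ((Sum.inr (b, t) : pDom), i)) ⁻¹' s) := by
    intro i
    rw [pDomMeasure, Measure.add_apply, Measure.map_apply measurable_inl (hi i),
      Measure.map_apply measurable_inr (hi i), Measure.prod_apply (measurable_inr (hi i)),
      lintegral_count, tsum_fintype]
    rfl
  simp only [this, Finset.sum_add_distrib]
  rw [Finset.sum_comm (s := Finset.univ (α := Fin n))]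
  rfl

instance (n : ℕ) : SigmaFinite (pVMeasure n) := by
  rw [← (measurePreserving_pearceyContourEquiv n).map_eq]
  exact (pearceyContourEquiv n).sigmaFinite_map

theorem exp_mul_I_pi_div_four :
    Complex.exp (Complex.I * ((Real.pi / 4 : ℝ) : ℂ))
      = ((√2 / 2 : ℝ) : ℂ) + ((√2 / 2 : ℝ) : ℂ) * Complex.I := by
  rw [mul_comm, Complex.exp_mul_I, ← Complex.ofReal_cos, ← Complex.ofReal_sin, Real.cos_pi_div_four,
    Real.sin_pi_div_four]

theorem exp_neg_mul_I_pi_div_four :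
    Complex.exp (-(Complex.I * ((Real.pi / 4 : ℝ) : ℂ)))
      = ((√2 / 2 : ℝ) : ℂ) - ((√2 / 2 : ℝ) : ℂ) * Complex.I := by
  rw [mul_comm, ← neg_mul, Complex.exp_mul_I, Complex.cos_neg, Complex.sin_neg,
    ← Complex.ofReal_cos, ← Complex.ofReal_sin, Real.cos_pi_div_four, Real.sin_pi_div_four]
  ring

theorem pγR_eq (t : ℝ) :
    pγR t = ((|t| * (√2 / 2) : ℝ) : ℂ) + ((-t * (√2 / 2) : ℝ) : ℂ) * Complex.I := by
  unfold pγR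
  split_ifs with h
  · rw [exp_mul_I_pi_div_four, abs_of_nonpos h]
    push_cast; ring
  · rw [exp_neg_mul_I_pi_div_four, abs_of_pos (not_le.1 h)]
    push_cast; ring

theorem measurable_pPt_inr (b : Bool) : Measurable fun t : ℝ => pPt (Sum.inr (b, t)) := by
  cases b <;> simp only [pPt, pγR_eq, if_true, Bool.false_eq_true, if_false] <;> fun_prop

theorem measurable_pγR' : Measurable pγR' :=
  Measurable.ite measurableSet_Iic measurable_const measurable_const

theorem measurable_pWt_inr (b : Bool) : Measurable fun t : ℝ => pWt (Sum.inr (b, t)) := by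
  have := measurable_pγR'
  cases b <;> simp only [pWt, if_true, Bool.false_eq_true, if_false] <;> fun_prop

theorem norm_pWt_inr (b : Bool) (t : ℝ) : ‖pWt (Sum.inr (b, t))‖ = 1 := by
  have h : ‖pγR' t‖ = 1 := by
    unfold pγR'
    split_ifs
    · rw [norm_neg, Complex.norm_exp]; simp
    · rw [Complex.norm_exp]; simp
  cases b <;> simp [pWt, h]

theorem pPt_inr_re_sq (b : Bool) (t : ℝ) : (pPt (Sum.inr (b, t))).re ^ 2 = t ^ 2 / 2 := by
  have h2 : (√2 : ℝ) ^ 2 = 2 := Real.sq_sqrt (by norm_num)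
  cases b <;> simp [pPt, pγR_eq, mul_pow, div_pow, h2] <;> ring

theorem pPt_inr_im_sq (b : Bool) (t : ℝ) : (pPt (Sum.inr (b, t))).im ^ 2 = t ^ 2 / 2 := by
  have h2 : (√2 : ℝ) ^ 2 = 2 := Real.sq_sqrt (by norm_num)
  cases b <;> simp [pPt, pγR_eq, mul_pow, div_pow, h2] <;> ring

theorem ΘP_inr_re (τi : ℝ) (b : Bool) (t : ℝ) :
    (ΘP τi 0 (pPt (Sum.inr (b, t)))).re = -t ^ 4 / 4 := by
  have h1 := pPt_inr_re_sq b t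
  have h2 := pPt_inr_im_sq b t
  set μ := pPt (Sum.inr (b, t))
  have e2 : (μ ^ 2).re = 0 := by rw [pow_two, Complex.mul_re, ← pow_two, ← pow_two, h1, h2, sub_self]
  have e3 : (μ ^ 2).im = 2 * (μ.re * μ.im) := by rw [pow_two, Complex.mul_im]; ring
  have e4 : (μ ^ 4).re = -t ^ 4 := by
    rw [show μ ^ 4 = μ ^ 2 * μ ^ 2 by ring, Complex.mul_re, e2, e3]
    linear_combination (-4) * μ.im ^ 2 * h1 - 2 * t ^ 2 * h2
  simp only [ΘP, Complex.sub_re, Complex.ofReal_zero, zero_mul, sub_zero]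
  rw [mul_div_assoc, Complex.re_ofReal_mul, show μ ^ 4 / 4 = μ ^ 4 / ((4 : ℝ) : ℂ) by norm_num,
    show μ ^ 2 / 2 = μ ^ 2 / ((2 : ℝ) : ℂ) by norm_num, Complex.div_ofReal_re,
    Complex.div_ofReal_re, e2, e4]
  ring

theorem ΘP_I_mul (τi y u : ℝ) :
    ΘP τi y (Complex.I * u) = ((u ^ 4 / 4 + τi * u ^ 2 / 2 : ℝ) : ℂ) - y * (Complex.I * u) := by
  simp only [ΘP, mul_pow, Complex.I_sq, Complex.I_pow_four]
  push_cast; ring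

theorem half_mul_abs_le_norm_sq (b : Bool) (t u : ℝ) :
    |t| * |u| / 2 ≤ ‖pPt (Sum.inr (b, t)) - Complex.I * u‖ ^ 2 := by
  have h1 := pPt_inr_re_sq b t
  have h2 := pPt_inr_im_sq b t
  set μ := pPt (Sum.inr (b, t))
  have hN : ‖μ - Complex.I * u‖ ^ 2 = μ.re ^ 2 + (μ.im - u) ^ 2 := by
    rw [← Complex.normSq_eq_norm_sq, Complex.normSq_apply]
    simp; ring
  rw [hN]
  have ht : |t| ^ 2 = t ^ 2 := sq_abs t
  have hu : |u| ^ 2 = u ^ 2 := sq_abs u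
  nlinarith [sq_nonneg (|t| - |u|), sq_nonneg (μ.im - u), sq_nonneg (2 * μ.im - u)]

theorem inv_norm_sub_le (b : Bool) {t u : ℝ} (ht : t ≠ 0) (hu : u ≠ 0) :
    ‖pPt (Sum.inr (b, t)) - Complex.I * u‖⁻¹
      ≤ √2 * (|t| ^ (-(1 / 2) : ℝ) * |u| ^ (-(1 / 2) : ℝ)) := by
  have h := half_mul_abs_le_norm_sq b t u
  have ht' := abs_pos.2 ht
  have hu' := abs_pos.2 hu
  have hsq : ∀ x : ℝ, 0 < x → (x ^ (-(1 / 2) : ℝ)) ^ 2 = x⁻¹ := by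
    intro x hx
    rw [← Real.rpow_natCast, ← Real.rpow_mul hx.le, ← Real.rpow_neg_one]
    norm_num
  refine (sq_le_sq₀ (by positivity) (by positivity)).1 ?_
  rw [mul_pow, mul_pow, hsq _ ht', hsq _ hu', Real.sq_sqrt (by norm_num), inv_pow,
    ← mul_inv, ← inv_inv (2 : ℝ), ← mul_inv]
  refine inv_anti₀ (by positivity) ?_
  linarith

theorem integrable_abs_rpow_mul_exp_neg_mul_sq {c : ℝ} (hc : 0 < c) :
    Integrable fun t : ℝ => |t| ^ (-(1 / 2) : ℝ) * Real.exp (-c * t ^ 2) := by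
  have h := integrable_rpow_mul_exp_neg_mul_sq hc (s := -(1 / 2)) (by norm_num)
  have h' := h.comp_neg
  refine (h.add h').congr ?_
  filter_upwards [Measure.ae_ne volume (0 : ℝ)] with t ht
  have key : ∀ x : ℝ, x < 0 → x ^ (-(1 / 2) : ℝ) = 0 := by
    intro x hx
    rw [Real.rpow_def_of_neg hx, show -(1 / 2) * Real.pi = -(Real.pi / 2) by ring, Real.cos_neg,
      Real.cos_pi_div_two, mul_zero]
  rcases lt_or_gt_of_ne ht with h0 | h0
  · simp only [Pi.add_apply]
    rw [key t h0, abs_of_neg h0, neg_sq]; ring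
  · simp only [Pi.add_apply]
    rw [key (-t) (by linarith), abs_of_pos h0]; ring

theorem exists_exp_quartic_le (A B : ℝ) :
    ∃ C : ℝ, ∀ t : ℝ, Real.exp (-t ^ 4 / 8 + A * t ^ 2 + B * |t|) ≤ C * Real.exp (-t ^ 2) := by
  refine ⟨Real.exp (2 * (A + 3 / 2) ^ 2 + B ^ 2 / 2), fun t => ?_⟩
  rw [← Real.exp_add]
  refine Real.exp_le_exp.2 ?_
  have ht : |t| ^ 2 = t ^ 2 := sq_abs t
  nlinarith [sq_nonneg (t ^ 2 - 4 * (A + 3 / 2)), sq_nonneg (B - |t|)]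

/-- A uniform Gaussian rate for the time differences of a strictly increasing family. -/
theorem exists_gaussian_rate {n : ℕ} {τ : Fin n → ℝ} (hτ : StrictMono τ) :
    ∃ c : ℝ, 0 < c ∧ c ≤ 1 ∧ ∀ i j, i < j → c ≤ (τ j - τ i) / 2 := by
  have h1 : ∀ᶠ c : ℝ in 𝓝[>] 0, ∀ i j, i < j → c ≤ (τ j - τ i) / 2 := by
    refine eventually_all.2 fun i => eventually_all.2 fun j => ?_
    by_cases h : i < j
    · have : (0 : ℝ) < (τ j - τ i) / 2 := by linarith [hτ h]
      filter_upwards [nhdsWithin_le_nhds (Iic_mem_nhds this)] with c hc _ using hc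
    · exact Eventually.of_forall fun c hc => absurd hc h
  obtain ⟨c, ⟨h0, h1⟩, h2⟩ := ((eventually_mem_nhdsWithin.and
    (nhdsWithin_le_nhds (Iic_mem_nhds one_pos))).and h1).exists
  exact ⟨c, h0, h1, h2⟩

section PearceyFactorization

variable {n : ℕ}

/-- The kernel `χ_{J_i}(y) e^{yλ}` from the contour to the channels of the Pearcey process. -/
noncomputable def pearceyB (J : Fin n → Set ℝ) (v : (Option Bool × Fin n) × ℝ) (z : Fin n × ℝ) : ℂ :=
  match v with
  | ((none, i), t) =>
      if i = z.1 then (J i).indicator (fun _ => (1 : ℂ)) z.2 * Complex.exp (z.2 * (Complex.I * t))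
      else 0
  | ((some _, _), _) => 0

/-- The kernel from the channels of the Pearcey process to the contour which, composed with
`pearceyB`, yields the Gaussian part of the Pearcey kernel. -/
noncomputable def pearceyQ (τ : Fin n → ℝ) (J : Fin n → Set ℝ) (z : Fin n × ℝ)
    (v : (Option Bool × Fin n) × ℝ) : ℂ :=
  match v with
  | ((none, j), u) =>
      if z.1 < j then
        -(1 / (2 * (Real.pi : ℂ) * Complex.I) * Complex.I) *
          ((J z.1).indicator (fun _ => (1 : ℂ)) z.2 *
            Complex.exp (-(z.2 * (Complex.I * u)) + ((τ j - τ z.1 : ℝ) : ℂ) * (Complex.I * u) ^ 2 / 2))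
      else 0
  | ((some b, j), u) =>
      if z.1 = j then
        -(1 / (2 * (Real.pi : ℂ) * Complex.I) * pWt (Sum.inr (b, u))) *
          ((J z.1).indicator (fun _ => (1 : ℂ)) z.2 *
            Complex.exp (ΘP (τ j) 0 (pPt (Sum.inr (b, u))) / 2 - z.2 * pPt (Sum.inr (b, u))))
      else 0

/-- The off-diagonal block of the integrable kernel, from `γ_L ∪ γ_R` to `iℝ`. -/
noncomputable def pearceyOffDiag (τ : Fin n → ℝ) (v w : (Option Bool × Fin n) × ℝ) : ℂ :=
  match v, w with
  | ((some b, i), t), ((none, j), u) =>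
      if t = 0 ∨ u = 0 then 0
      else Complex.I * (1 / (2 * (Real.pi : ℂ) * Complex.I) *
        Complex.exp (ΘP (τ i) 0 (pPt (Sum.inr (b, t))) / 2) *
          Complex.exp (-ΘP (τ j) 0 (Complex.I * u))) / (pPt (Sum.inr (b, t)) - Complex.I * u)
  | _, _ => 0

/-- The row weight on the Pearcey contour. -/
noncomputable def pearceyRowWeight (v : (Option Bool × Fin n) × ℝ) : ℝ :=
  match v with
  | ((none, _), _) => 1
  | ((some _, _), t) => |t| ^ (-(1 / 2) : ℝ)

/-- The column weight on the Pearcey contour. -/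
noncomputable def pearceyColWeight (c : ℝ) (v : (Option Bool × Fin n) × ℝ) : ℝ :=
  match v with
  | ((none, _), t) => (1 + |t| ^ (-(1 / 2) : ℝ)) * Real.exp (-c * t ^ 2)
  | ((some _, _), t) => Real.exp (-c * t ^ 2)

/-- The weight on the channels of the Pearcey process. -/
noncomputable def pearceyChannelWeight (J : Fin n → Set ℝ) (z : Fin n × ℝ) : ℝ :=
  (J z.1).indicator (fun _ => (1 : ℝ)) z.2

theorem pearceyRowWeight_nonneg (v : (Option Bool × Fin n) × ℝ) : 0 ≤ pearceyRowWeight v := by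
  obtain ⟨⟨_ | b, i⟩, t⟩ := v
  · exact zero_le_one
  · exact Real.rpow_nonneg (abs_nonneg t) _

theorem pearceyColWeight_nonneg (c : ℝ) (v : (Option Bool × Fin n) × ℝ) :
    0 ≤ pearceyColWeight c v := by
  obtain ⟨⟨_ | b, i⟩, t⟩ := v
  · exact mul_nonneg (add_nonneg zero_le_one (Real.rpow_nonneg (abs_nonneg t) _))
      (Real.exp_nonneg _)
  · exact Real.exp_nonneg _

theorem pearceyChannelWeight_nonneg (J : Fin n → Set ℝ) (z : Fin n × ℝ) :
    0 ≤ pearceyChannelWeight J z :=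
  Set.indicator_nonneg (fun _ _ => zero_le_one) _

theorem integrable_pearceyRowWeight_mul_colWeight {c : ℝ} (hc : 0 < c) :
    Integrable (fun v : (Option Bool × Fin n) × ℝ => pearceyRowWeight v * pearceyColWeight c v)
      ((Measure.count : Measure (Option Bool × Fin n)).prod volume) := by
  have h1 := integrable_exp_neg_mul_sq hc
  have h2 := integrable_abs_rpow_mul_exp_neg_mul_sq hc
  refine integrable_count_prod (Measurable.aestronglyMeasurable
    (measurable_from_prod_countable_right ?_)) ?_
  · rintro ⟨_ | b, i⟩
    · simp only [pearceyRowWeight, pearceyColWeight]; fun_prop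
    · simp only [pearceyRowWeight, pearceyColWeight]; fun_prop
  · rintro ⟨_ | b, i⟩
    · simp only [pearceyRowWeight, pearceyColWeight]
      refine (h1.add h2).congr (Eventually.of_forall fun t => ?_)
      simp only [Pi.add_apply]; ring
    · exact h2

theorem integrable_pearceyChannelWeight_sq {J : Fin n → Set ℝ} (hm : ∀ i, MeasurableSet (J i))
    (hJ : ∀ i, IsCompact (J i)) :
    Integrable (fun z : Fin n × ℝ => pearceyChannelWeight J z * pearceyChannelWeight J z)
      (finLineMeasure n) := by
  have e : (fun z : Fin n × ℝ => pearceyChannelWeight J z * pearceyChannelWeight J z)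
      = pearceyChannelWeight J := by
    funext z
    by_cases h : z.2 ∈ J z.1 <;> simp [pearceyChannelWeight, h]
  rw [e]
  refine integrable_count_prod (Measurable.aestronglyMeasurable
    (measurable_from_prod_countable_right fun i => measurable_const.indicator (hm i))) fun i => ?_
  exact (integrable_indicator_iff (hm i)).2 (integrableOn_const (hJ i).measure_lt_top.ne)

theorem norm_indicator_one (s : Set ℝ) (x : ℝ) :
    ‖s.indicator (fun _ => (1 : ℂ)) x‖ = s.indicator (fun _ => (1 : ℝ)) x := by
  by_cases h : x ∈ s <;> simp [h]

theorem norm_exp_mul_I_mul (x t : ℝ) : ‖Complex.exp (x * (Complex.I * t))‖ = 1 := by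
  rw [Complex.norm_exp]; simp

theorem exists_isDominatedKernel_pearceyB {J : Fin n → Set ℝ} (hm : ∀ i, MeasurableSet (J i)) :
    ∃ C, 0 ≤ C ∧ IsDominatedKernel pearceyRowWeight (pearceyChannelWeight J) C (pearceyB J) := by
  refine exists_isDominatedKernel_of_slices pearceyRowWeight_nonneg
    (pearceyChannelWeight_nonneg J) ?_ ?_
  · rintro ⟨_ | b, i⟩ j
    · simp only [pearceyB]
      by_cases h : i = j
      · have : Measurable fun p : ℝ × ℝ => (J i).indicator (fun _ => (1 : ℂ)) p.2 :=
          (measurable_const.indicator (hm i)).comp measurable_snd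
        simp only [h, if_true] at this ⊢
        fun_prop
      · simp only [h, if_false]; fun_prop
    · simp only [pearceyB]; fun_prop
  · rintro ⟨_ | b, i⟩ j
    · refine ⟨1, fun t u => ?_⟩
      simp only [pearceyB, pearceyRowWeight, one_mul]
      split_ifs with h
      · subst h
        rw [norm_mul, norm_indicator_one, norm_exp_mul_I_mul, mul_one]
        rfl
      · simpa using pearceyChannelWeight_nonneg J (j, u)
    · refine ⟨1, fun t u => ?_⟩
      simp only [pearceyB, norm_zero, one_mul]
      exact mul_nonneg (pearceyRowWeight_nonneg _) (pearceyChannelWeight_nonneg _ _)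

theorem abs_re_pPt_inr_le (b : Bool) (t : ℝ) : |(pPt (Sum.inr (b, t))).re| ≤ |t| := by
  refine sq_le_sq.1 ?_
  rw [pPt_inr_re_sq]
  nlinarith [sq_nonneg t]

theorem exp_neg_sq_le {c : ℝ} (hc : c ≤ 1) (t : ℝ) :
    Real.exp (-t ^ 2) ≤ Real.exp (-c * t ^ 2) :=
  Real.exp_le_exp.2 (by nlinarith [sq_nonneg t])

theorem exists_isDominatedKernel_pearceyQ {τ : Fin n → ℝ} {J : Fin n → Set ℝ} {c : ℝ}
    (hm : ∀ i, MeasurableSet (J i)) (hJ : ∀ i, IsCompact (J i)) (hc1 : c ≤ 1)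
    (hc : ∀ i j, i < j → c ≤ (τ j - τ i) / 2) :
    ∃ C, 0 ≤ C ∧
      IsDominatedKernel (pearceyChannelWeight J) (pearceyColWeight c) C (pearceyQ τ J) := by
  refine exists_isDominatedKernel_of_slices (pearceyChannelWeight_nonneg J)
    (pearceyColWeight_nonneg c) ?_ ?_
  · intro i
    have : Measurable fun p : ℝ × ℝ => (J i).indicator (fun _ => (1 : ℂ)) p.1 :=
      (measurable_const.indicator (hm i)).comp measurable_fst
    rintro ⟨_ | b, j⟩
    · simp only [pearceyQ]
      split_ifs <;> fun_prop
    · have h1 : Measurable fun p : ℝ × ℝ => pPt (Sum.inr (b, p.2)) :=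
        (measurable_pPt_inr b).comp measurable_snd
      have h2 : Measurable fun p : ℝ × ℝ => pWt (Sum.inr (b, p.2)) :=
        (measurable_pWt_inr b).comp measurable_snd
      simp only [pearceyQ, ΘP]
      split_ifs <;> fun_prop
  · rintro i ⟨_ | b, j⟩
    · refine ⟨‖1 / (2 * (Real.pi : ℂ) * Complex.I) * Complex.I‖, fun x u => ?_⟩
      simp only [pearceyQ]
      split_ifs with h
      · rw [norm_mul, norm_neg, norm_mul _ (Complex.exp _), norm_indicator_one, Complex.norm_exp]
        refine mul_le_mul_of_nonneg_left (mul_le_mul_of_nonneg_left ?_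
          (pearceyChannelWeight_nonneg J (i, x))) (norm_nonneg _)
        have e : (-((x : ℂ) * (Complex.I * u))
            + ((τ j - τ i : ℝ) : ℂ) * (Complex.I * u) ^ 2 / 2).re = -((τ j - τ i) / 2) * u ^ 2 := by
          have : -((x : ℂ) * (Complex.I * u)) + ((τ j - τ i : ℝ) : ℂ) * (Complex.I * u) ^ 2 / 2
              = ((-((τ j - τ i) / 2) * u ^ 2 : ℝ) : ℂ) + ((-(x * u) : ℝ) : ℂ) * Complex.I := by
            rw [mul_pow, Complex.I_sq]; push_cast; ring
          rw [this, Complex.add_re, Complex.re_ofReal_mul, Complex.I_re, Complex.ofReal_re]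
          ring
        rw [e]
        have h1 : Real.exp (-((τ j - τ i) / 2) * u ^ 2) ≤ Real.exp (-c * u ^ 2) :=
          Real.exp_le_exp.2 (by nlinarith [hc i j h, sq_nonneg u])
        refine h1.trans (le_mul_of_one_le_left (Real.exp_nonneg _) ?_)
        exact le_add_of_nonneg_right (Real.rpow_nonneg (abs_nonneg _) _)
      · rw [norm_zero]
        exact mul_nonneg (norm_nonneg _) (mul_nonneg (pearceyChannelWeight_nonneg J _)
          (pearceyColWeight_nonneg c _))
    · obtain ⟨A, hA⟩ := (hJ i).isBounded.exists_norm_le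
      obtain ⟨C, hC⟩ := exists_exp_quartic_le 0 A
      have hC0 : 0 ≤ C := by
        have := (Real.exp_nonneg _).trans (hC 0)
        exact nonneg_of_mul_nonneg_left this (Real.exp_pos _)
      refine ⟨‖1 / (2 * (Real.pi : ℂ) * Complex.I)‖ * C, fun x u => ?_⟩
      simp only [pearceyQ]
      split_ifs with h
      · rw [norm_mul, norm_neg, norm_mul _ (pWt _), norm_pWt_inr, mul_one, norm_mul _ (Complex.exp _),
          norm_indicator_one, mul_assoc ‖_‖ C]
        refine mul_le_mul_of_nonneg_left ?_ (norm_nonneg _)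
        by_cases hx : x ∈ J i
        · simp only [hx, Set.indicator_of_mem, one_mul, pearceyChannelWeight, pearceyColWeight]
          refine (le_trans ?_ (hC u)).trans (mul_le_mul_of_nonneg_left (exp_neg_sq_le hc1 u) hC0)
          rw [Complex.norm_exp]
          refine Real.exp_le_exp.2 ?_
          have e2 : (ΘP (τ j) 0 (pPt (Sum.inr (b, u))) / 2).re = -u ^ 4 / 8 := by
            rw [show ΘP (τ j) 0 (pPt (Sum.inr (b, u))) / 2
              = ΘP (τ j) 0 (pPt (Sum.inr (b, u))) / ((2 : ℝ) : ℂ) by norm_num,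
              Complex.div_ofReal_re, ΘP_inr_re]
            ring
          rw [Complex.sub_re, e2, Complex.re_ofReal_mul]
          have h1 : |x * (pPt (Sum.inr (b, u))).re| ≤ A * |u| := by
            rw [abs_mul]
            exact mul_le_mul (hA x hx) (abs_re_pPt_inr_le b u) (abs_nonneg _)
              ((norm_nonneg _).trans (hA x hx))
          linarith [neg_abs_le (x * (pPt (Sum.inr (b, u))).re)]
        · simp [hx, pearceyChannelWeight]
      · rw [norm_zero]
        exact mul_nonneg (mul_nonneg (norm_nonneg _) hC0)
          (mul_nonneg (pearceyChannelWeight_nonneg J _) (pearceyColWeight_nonneg c _))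

theorem exists_isDominatedKernel_pearceyOffDiag (τ : Fin n → ℝ) {c : ℝ} (hc1 : c ≤ 1) :
    ∃ C, 0 ≤ C ∧
      IsDominatedKernel pearceyRowWeight (pearceyColWeight c) C (pearceyOffDiag τ) := by
  refine exists_isDominatedKernel_of_slices pearceyRowWeight_nonneg
    (pearceyColWeight_nonneg c) ?_ ?_
  · rintro ⟨_ | b, i⟩ ⟨_ | b', j⟩
    · simp only [pearceyOffDiag]; fun_prop
    · simp only [pearceyOffDiag]; fun_prop
    · simp only [pearceyOffDiag]
      have h1 : Measurable fun p : ℝ × ℝ => pPt (Sum.inr (b, p.1)) :=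
        (measurable_pPt_inr b).comp measurable_fst
      refine Measurable.ite ?_ measurable_const ?_
      · exact (measurableSet_eq_fun measurable_fst measurable_const).union
          (measurableSet_eq_fun measurable_snd measurable_const)
      · simp only [ΘP]
        fun_prop
    · simp only [pearceyOffDiag]; fun_prop
  · have hzero : ∀ v w : (Option Bool × Fin n) × ℝ,
        0 ≤ pearceyRowWeight v * pearceyColWeight c w := fun v w =>
      mul_nonneg (pearceyRowWeight_nonneg _) (pearceyColWeight_nonneg _ _)
    rintro ⟨_ | b, i⟩ ⟨_ | b', j⟩
    · exact ⟨1, fun t u => by simpa [pearceyOffDiag] using hzero _ _⟩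
    · exact ⟨1, fun t u => by simpa [pearceyOffDiag] using hzero _ _⟩
    · obtain ⟨C, hC⟩ := exists_exp_quartic_le (-τ j / 2) 0
      have hC0 : 0 ≤ C := by
        have := (Real.exp_nonneg _).trans (hC 0)
        exact nonneg_of_mul_nonneg_left this (Real.exp_pos _)
      refine ⟨‖1 / (2 * (Real.pi : ℂ) * Complex.I)‖ * C * √2, fun t u => ?_⟩
      simp only [pearceyOffDiag]
      split_ifs with h
      · rw [norm_zero]
        exact mul_nonneg (by positivity) (hzero _ _)
      · rw [not_or] at h
        rw [norm_div, norm_mul, Complex.norm_I, one_mul, norm_mul, norm_mul, div_eq_mul_inv]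
        have h1 := inv_norm_sub_le b h.1 h.2
        have h2 : ‖Complex.exp (ΘP (τ i) 0 (pPt (Sum.inr (b, t))) / 2)‖ ≤ 1 := by
          rw [Complex.norm_exp, show ΘP (τ i) 0 (pPt (Sum.inr (b, t))) / 2
              = ΘP (τ i) 0 (pPt (Sum.inr (b, t))) / ((2 : ℝ) : ℂ) by norm_num,
              Complex.div_ofReal_re, ΘP_inr_re]
          refine Real.exp_le_one_iff.2 ?_
          have : 0 ≤ t ^ 4 := by positivity
          linarith
        have h3 : ‖Complex.exp (-ΘP (τ j) 0 (Complex.I * u))‖ ≤ C * Real.exp (-c * u ^ 2) := by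
          refine (le_trans ?_ (hC u)).trans (mul_le_mul_of_nonneg_left (exp_neg_sq_le hc1 u) hC0)
          rw [Complex.norm_exp, ΘP_I_mul, Complex.ofReal_zero, zero_mul, sub_zero, Complex.neg_re,
            Complex.ofReal_re]
          refine Real.exp_le_exp.2 ?_
          have : 0 ≤ u ^ 4 := by positivity
          linarith
        have hw : 0 ≤ |t| ^ (-(1 / 2) : ℝ) := Real.rpow_nonneg (abs_nonneg t) _
        have hw' : 0 ≤ |u| ^ (-(1 / 2) : ℝ) := Real.rpow_nonneg (abs_nonneg u) _
        simp only [pearceyRowWeight, pearceyColWeight]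
        calc _ ≤ ‖1 / (2 * (Real.pi : ℂ) * Complex.I)‖ * 1 * (C * Real.exp (-c * u ^ 2)) *
              (√2 * (|t| ^ (-(1 / 2) : ℝ) * |u| ^ (-(1 / 2) : ℝ))) := by gcongr
          _ = ‖1 / (2 * (Real.pi : ℂ) * Complex.I)‖ * C * √2 * (|t| ^ (-(1 / 2) : ℝ) *
              (|u| ^ (-(1 / 2) : ℝ) * Real.exp (-c * u ^ 2))) := by ring
          _ ≤ _ := by gcongr; linarith
    · exact ⟨1, fun t u => by simpa [pearceyOffDiag] using hzero _ _⟩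

end PearceyFactorization

section PearceyKernels

variable {n : ℕ}

theorem integral_indicator_mul_exp_mul_exp {k : ℕ} {a : Fin (2 * k) → ℝ} (ha : StrictMono a)
    {ξ η : ℂ} (h : ξ ≠ η) (c : ℂ) :
    ∫ x : ℝ, (multiInterval a).indicator (fun _ => (1 : ℂ)) x * Complex.exp (x * ξ) *
        ((multiInterval a).indicator (fun _ => (1 : ℂ)) x * Complex.exp (c - x * η))
      = -(∑ s : Fin (2 * k), (-1) ^ (s : ℕ) *
          (Complex.exp (a s * ξ) * Complex.exp (c - a s * η))) / (ξ - η) := by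
  have e : ∀ x : ℝ, Complex.exp (x * ξ) * Complex.exp (c - x * η)
      = Complex.exp (x * (ξ - η)) * Complex.exp c := by
    intro x
    rw [← Complex.exp_add, ← Complex.exp_add]
    ring_nf
  have e' : ∀ x : ℝ, (multiInterval a).indicator (fun _ => (1 : ℂ)) x * Complex.exp (x * ξ) *
        ((multiInterval a).indicator (fun _ => (1 : ℂ)) x * Complex.exp (c - x * η))
      = (multiInterval a).indicator (fun x : ℝ => Complex.exp (x * (ξ - η)) * Complex.exp c) x := by
    intro x
    by_cases hx : x ∈ multiInterval a <;> simp [hx, e]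
  simp only [e', e]
  rw [integral_indicator (measurableSet_multiInterval a), integral_mul_const,
    integral_multiInterval_exp ha (sub_ne_zero.2 h)]
  simp only [← mul_assoc]
  rw [← Finset.sum_mul]
  ring

theorem kerComp_pearceyB_apply_none {J : Fin n → Set ℝ} {Q : Fin n × ℝ → (Option Bool × Fin n) × ℝ → ℂ}
    {w : (Option Bool × Fin n) × ℝ} (i : Fin n) (t : ℝ)
    (hint : Integrable (fun z => pearceyB J ((none, i), t) z * Q z w) (finLineMeasure n)) :
    kerComp (finLineMeasure n) (pearceyB J) Q ((none, i), t) w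
      = ∫ x : ℝ, (J i).indicator (fun _ => (1 : ℂ)) x * Complex.exp (x * (Complex.I * t)) *
          Q (i, x) w := by
  unfold kerComp finLineMeasure
  rw [integral_count_prod hint, Finset.sum_eq_single i]
  · simp [pearceyB]
  · intro j _ hj
    simp [pearceyB, hj.symm]
  · simp

theorem pearceyKP_none_none (τ : Fin n → ℝ) (k : Fin n → ℕ) (a : ∀ i, Fin (2 * k i) → ℝ)
    (i j : Fin n) (t u : ℝ) :
    pearceyKP τ k a (Sum.inl t, i) (Sum.inl u, j)
      = if i < j then Complex.I * (1 / (2 * (Real.pi : ℂ) * Complex.I)) *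
          (∑ s : Fin (2 * k i), (-1) ^ (s : ℕ) * (Complex.exp (a i s * (Complex.I * t)) *
            Complex.exp (((τ j - τ i : ℝ) : ℂ) * (Complex.I * u) ^ 2 / 2
              - a i s * (Complex.I * u)))) / (Complex.I * t - Complex.I * u)
        else 0 := by
  unfold pearceyKP
  simp only [pWt, pPt, pearceyF, pearceyG, Fintype.sum_sum_type, Fintype.sum_sigma,
    Finset.univ_unique, Finset.sum_singleton, mul_zero, zero_mul, zero_add]
  rw [Finset.sum_eq_single i]
  · simp only [if_true]
    split_ifs with h
    · simp only [Finset.mul_sum, Finset.sum_div]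
      refine Finset.sum_congr rfl fun s _ => ?_
      rw [show -(a i s : ℂ) * (Complex.I * u)
        + ((τ j - τ i : ℝ) : ℂ) * (Complex.I * u) ^ 2 / 2
        = ((τ j - τ i : ℝ) : ℂ) * (Complex.I * u) ^ 2 / 2 - a i s * (Complex.I * u) by ring]
      ring
    · simp
  · intro i' _ hi'
    simp [hi']
  · simp

theorem pearceyKP_none_some (τ : Fin n → ℝ) (k : Fin n → ℕ) (a : ∀ i, Fin (2 * k i) → ℝ)
    (b : Bool) (i j : Fin n) (t u : ℝ) :
    pearceyKP τ k a (Sum.inl t, i) (Sum.inr (b, u), j)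
      = if i = j then pWt (Sum.inr (b, u)) * (1 / (2 * (Real.pi : ℂ) * Complex.I)) *
          (∑ s : Fin (2 * k i), (-1) ^ (s : ℕ) * (Complex.exp (a i s * (Complex.I * t)) *
            Complex.exp (ΘP (τ j) 0 (pPt (Sum.inr (b, u))) / 2 - a i s * pPt (Sum.inr (b, u))))) /
              (Complex.I * t - pPt (Sum.inr (b, u)))
        else 0 := by
  unfold pearceyKP
  simp only [pearceyF, pearceyG, Fintype.sum_sum_type, Fintype.sum_sigma,
    Finset.univ_unique, Finset.sum_singleton, mul_zero, zero_add]
  rw [Finset.sum_eq_single i]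
  · simp only [if_true]
    split_ifs with h
    · simp only [Finset.mul_sum, Finset.sum_div]
      refine Finset.sum_congr rfl fun s _ => ?_
      simp only [pPt]
      ring
    · simp
  · intro i' _ hi'
    simp [hi']
  · simp

theorem pearceyKP_some_none (τ : Fin n → ℝ) (k : Fin n → ℕ) (a : ∀ i, Fin (2 * k i) → ℝ)
    (b : Bool) (i j : Fin n) {t u : ℝ} (ht : t ≠ 0) (hu : u ≠ 0) :
    pearceyKP τ k a (Sum.inr (b, t), i) (Sum.inl u, j)
      = pearceyOffDiag τ ((some b, i), t) ((none, j), u) := by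
  simp only [pearceyKP, pearceyOffDiag, ht, hu, or_self, if_false]
  simp [pearceyF, pearceyG, pWt, pPt, Fintype.sum_sum_type]

theorem pearceyKP_some_some (τ : Fin n → ℝ) (k : Fin n → ℕ) (a : ∀ i, Fin (2 * k i) → ℝ)
    (b b' : Bool) (i j : Fin n) (t u : ℝ) :
    pearceyKP τ k a (Sum.inr (b, t), i) (Sum.inr (b', u), j) = 0 := by
  simp [pearceyKP, pearceyF, pearceyG, Fintype.sum_sum_type]

theorem kerComp_pearceyB_pearceyQ_diag (τ : Fin n → ℝ) (J : Fin n → Set ℝ)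
    (v : (Option Bool × Fin n) × ℝ) :
    kerComp (finLineMeasure n) (pearceyB J) (pearceyQ τ J) v v = 0 := by
  unfold kerComp
  refine integral_eq_zero_of_ae (Eventually.of_forall fun z => ?_)
  obtain ⟨⟨_ | b, i⟩, t⟩ := v
  · by_cases h : i = z.1
    · subst h
      simp [pearceyQ]
    · simp [pearceyB, h]
  · simp [pearceyB]

theorem pearceyOffDiag_diag (τ : Fin n → ℝ) (v : (Option Bool × Fin n) × ℝ) :
    pearceyOffDiag τ v v = 0 := by
  obtain ⟨⟨_ | b, i⟩, t⟩ := v <;> rfl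

theorem kerComp_pearceyOffDiag_self (τ : Fin n → ℝ)
    (ρ : Measure ((Option Bool × Fin n) × ℝ)) :
    kerComp ρ (pearceyOffDiag τ) (pearceyOffDiag τ) = 0 := by
  funext v w
  refine integral_eq_zero_of_ae (Eventually.of_forall fun x => ?_)
  obtain ⟨⟨_ | b, i⟩, t⟩ := v <;> obtain ⟨⟨_ | b', i'⟩, t'⟩ := x <;> simp [pearceyOffDiag]

theorem pearceyKP_eq_kerComp_add (τ : Fin n → ℝ) (k : Fin n → ℕ) {a : ∀ i, Fin (2 * k i) → ℝ}
    (ha : ∀ i, StrictMono (a i)) {c : ℝ} (hc1 : c ≤ 1) (hc : ∀ i j, i < j → c ≤ (τ j - τ i) / 2)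
    {v w : (Option Bool × Fin n) × ℝ} (hv : v.2 ≠ 0) (hw : w.2 ≠ 0) (hvw : |v.2| ≠ |w.2|) :
    pearceyKP τ k a (pearceyContourEquiv n v) (pearceyContourEquiv n w)
      = kerComp (finLineMeasure n) (pearceyB fun i => multiInterval (a i))
          (pearceyQ τ fun i => multiInterval (a i)) v w + pearceyOffDiag τ v w := by
  have hm := fun i => measurableSet_multiInterval (a i)
  have hJ := fun i => isCompact_multiInterval (a i)
  obtain ⟨_, _, hB⟩ := exists_isDominatedKernel_pearceyB hm
  obtain ⟨_, _, hQ⟩ := exists_isDominatedKernel_pearceyQ (τ := τ) hm hJ hc1 hc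
  have hint := hB.integrable_mul hQ (integrable_pearceyChannelWeight_sq hm hJ)
  obtain ⟨⟨_ | b, i⟩, t⟩ := v <;> obtain ⟨⟨_ | b', j⟩, u⟩ := w
  · rw [kerComp_pearceyB_apply_none i t (hint _ _)]
    simp only [pearceyContourEquiv_none, pearceyKP_none_none, pearceyQ, pearceyOffDiag, add_zero]
    split_ifs with h
    · have hne : Complex.I * (t : ℂ) ≠ Complex.I * u := by
        intro h
        have := mul_left_cancel₀ Complex.I_ne_zero h
        exact hvw (by simp only [Complex.ofReal_inj.1 this])
      have := integral_indicator_mul_exp_mul_exp (ha i) hne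
        (((τ j - τ i : ℝ) : ℂ) * (Complex.I * u) ^ 2 / 2)
      simp only [neg_add_eq_sub, mul_left_comm _ (-(1 / (2 * (Real.pi : ℂ) * Complex.I) * Complex.I))]
      rw [integral_const_mul, this]
      ring
    · simp
  · rw [kerComp_pearceyB_apply_none i t (hint _ _)]
    simp only [pearceyContourEquiv_none, pearceyContourEquiv_some, pearceyKP_none_some, pearceyQ,
      pearceyOffDiag, add_zero]
    split_ifs with h
    · have hne : Complex.I * (t : ℂ) ≠ pPt (Sum.inr (b', u)) := by
        intro h
        have := pPt_inr_re_sq b' u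
        rw [← h] at this
        simp only [Complex.mul_re, Complex.I_re, Complex.ofReal_re, Complex.I_im, Complex.ofReal_im,
          zero_mul, mul_zero, sub_self] at this
        exact hw (pow_eq_zero_iff two_ne_zero |>.1 (show u ^ 2 = 0 by linarith))
      have := integral_indicator_mul_exp_mul_exp (ha i) hne
        (ΘP (τ j) 0 (pPt (Sum.inr (b', u))) / 2)
      simp only [mul_left_comm _ (-(1 / (2 * (Real.pi : ℂ) * Complex.I) * pWt (Sum.inr (b', u))))]
      rw [integral_const_mul, this]
      ring
    · simp
  · rw [pearceyContourEquiv_none, pearceyContourEquiv_some, pearceyKP_some_none _ _ _ _ _ _ hv hw]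
    simp [kerComp, pearceyB]
  · rw [pearceyContourEquiv_some, pearceyContourEquiv_some, pearceyKP_some_some]
    simp [kerComp, pearceyB, pearceyOffDiag]

theorem pearceyKP_diag (τ : Fin n → ℝ) (k : Fin n → ℕ) (a : ∀ i, Fin (2 * k i) → ℝ)
    (p : pDom × Fin n) : pearceyKP τ k a p p = 0 := by
  simp [pearceyKP]

end PearceyKernels

theorem fredholmDet_mul_indicator {X : Type} [MeasurableSpace X] (μ : Measure X) (s : Set X)
    (K : X → X → ℂ) :
    fredholmDet μ (fun x y => s.indicator (fun _ => (1 : ℂ)) x * K x y)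
      = fredholmDet μ (fun x y =>
          s.indicator (fun _ => (1 : ℂ)) x * K x y * s.indicator (fun _ => (1 : ℂ)) y) := by
  unfold fredholmDet
  congr 1
  refine tsum_congr fun m => ?_
  congr 1
  refine integral_congr_ae (Eventually.of_forall fun x => ?_)
  by_cases h : ∀ i, x i ∈ s
  · simp [h]
  · obtain ⟨i, hi⟩ := not_forall.1 h
    dsimp only
    rw [Matrix.det_eq_zero_of_row_eq_zero i (by simp [hi]),
      Matrix.det_eq_zero_of_row_eq_zero i (by simp [hi])]

theorem integral_exp_gaussian_mul_exp {δ : ℝ} (hδ : 0 < δ) (x y : ℝ) :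
    ∫ u : ℝ, Complex.exp (-(x * (Complex.I * u)) + (δ : ℂ) * (Complex.I * u) ^ 2 / 2) *
        Complex.exp (y * (Complex.I * u))
      = ((2 * Real.pi * (1 / √(2 * Real.pi * δ)) : ℝ) : ℂ) *
          Complex.exp ((-(x - y) ^ 2 / (2 * δ) : ℝ) : ℂ) := by
  have hb : 0 < ((δ / 2 : ℝ) : ℂ).re := by simpa using hδ
  have h := fourierIntegral_gaussian hb ((y - x : ℝ) : ℂ)
  have e : ∀ u : ℝ, Complex.exp (-(x * (Complex.I * u)) + (δ : ℂ) * (Complex.I * u) ^ 2 / 2) *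
        Complex.exp (y * (Complex.I * u))
      = Complex.exp (Complex.I * ((y - x : ℝ) : ℂ) * u) *
          Complex.exp (-((δ / 2 : ℝ) : ℂ) * (u : ℂ) ^ 2) := by
    intro u
    rw [← Complex.exp_add, ← Complex.exp_add, mul_pow, Complex.I_sq]
    congr 1
    push_cast
    ring
  simp only [e]
  rw [h]
  congr 1
  · rw [← Complex.ofReal_div, show (1 / 2 : ℂ) = ((1 / 2 : ℝ) : ℂ) by norm_num,
      ← Complex.ofReal_cpow (by positivity), ← Real.sqrt_eq_rpow]
    congr 1
    have h1 : 0 < 2 * Real.pi * δ := by positivity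
    rw [show Real.pi / (δ / 2) = (2 * Real.pi) ^ 2 / (2 * Real.pi * δ) by field_simp,
      Real.sqrt_div (by positivity), Real.sqrt_sq (by positivity)]
    ring
  · congr 1
    push_cast
    field_simp
    ring

section PearceyDeterminant

variable {n : ℕ}

theorem kerComp_pearceyB_right {Z : Type} {J : Fin n → Set ℝ}
    {K : Z → (Option Bool × Fin n) × ℝ → ℂ} {z : Z} (j : Fin n) (y : ℝ)
    (hint : Integrable (fun v => K z v * pearceyB J v (j, y))
      ((Measure.count : Measure (Option Bool × Fin n)).prod volume)) :
    kerComp ((Measure.count : Measure (Option Bool × Fin n)).prod volume) K (pearceyB J) z (j, y)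
      = ∫ u : ℝ, K z ((none, j), u) *
          ((J j).indicator (fun _ => (1 : ℂ)) y * Complex.exp (y * (Complex.I * u))) := by
  unfold kerComp
  rw [integral_count_prod hint, Finset.sum_eq_single (none, j)]
  · simp [pearceyB]
  · rintro ⟨_ | b, l⟩ _ h
    · have : l ≠ j := fun e => h (by rw [e])
      simp [pearceyB, this]
    · simp [pearceyB]
  · simp

theorem kerComp_pearceyQ_pearceyB {τ : Fin n → ℝ} (hτ : StrictMono τ) {J : Fin n → Set ℝ}
    {i j : Fin n} {x y : ℝ}
    (hint : Integrable (fun v => pearceyQ τ J (i, x) v * pearceyB J v (j, y))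
      ((Measure.count : Measure (Option Bool × Fin n)).prod volume)) :
    kerComp ((Measure.count : Measure (Option Bool × Fin n)).prod volume) (pearceyQ τ J)
        (pearceyB J) (i, x) (j, y)
      = (J i).indicator (fun _ => (1 : ℂ)) x * -pearceyQKer τ i j x y *
          (J j).indicator (fun _ => (1 : ℂ)) y := by
  rw [kerComp_pearceyB_right j y hint]
  simp only [pearceyQ, pearceyQKer, hτ.lt_iff_lt]
  split_ifs with h
  · have hδ : 0 < τ j - τ i := sub_pos.2 (hτ h)
    have e : ∀ u : ℝ, -(1 / (2 * (Real.pi : ℂ) * Complex.I) * Complex.I) *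
          ((J i).indicator (fun _ => (1 : ℂ)) x *
            Complex.exp (-(x * (Complex.I * u)) + ((τ j - τ i : ℝ) : ℂ) * (Complex.I * u) ^ 2 / 2)) *
          ((J j).indicator (fun _ => (1 : ℂ)) y * Complex.exp (y * (Complex.I * u)))
        = -(1 / (2 * (Real.pi : ℂ))) * ((J i).indicator (fun _ => (1 : ℂ)) x *
            (J j).indicator (fun _ => (1 : ℂ)) y) *
          (Complex.exp (-(x * (Complex.I * u)) + ((τ j - τ i : ℝ) : ℂ) * (Complex.I * u) ^ 2 / 2) *
            Complex.exp (y * (Complex.I * u))) := by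
      intro u
      have : 1 / (2 * (Real.pi : ℂ) * Complex.I) * Complex.I = 1 / (2 * (Real.pi : ℂ)) := by
        have := Complex.I_ne_zero
        field_simp
      rw [this]
      ring
    simp only [e]
    rw [integral_const_mul, integral_exp_gaussian_mul_exp hδ, Complex.ofReal_mul,
      Complex.ofReal_mul, Complex.ofReal_ofNat]
    have hπ : (Real.pi : ℂ) ≠ 0 := Complex.ofReal_ne_zero.2 Real.pi_ne_zero
    field_simp
  · simp

theorem pearceyQ_mul_integral_pearceyOffDiag (τ : Fin n → ℝ) (J : Fin n → Set ℝ) (b : Bool)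
    (i j : Fin n) (x y : ℝ) {t : ℝ} (ht : t ≠ 0) :
    pearceyQ τ J (i, x) ((some b, i), t) *
        ∫ u : ℝ, pearceyOffDiag τ ((some b, i), t) ((none, j), u) *
          ((J j).indicator (fun _ => (1 : ℂ)) y * Complex.exp (y * (Complex.I * u)))
      = (J i).indicator (fun _ => (1 : ℂ)) x * (1 / (2 * (Real.pi : ℂ) * Complex.I)) ^ 2 *
          (J j).indicator (fun _ => (1 : ℂ)) y * (pWt (Sum.inr (b, t)) * ∫ u : ℝ, Complex.I *
            (Complex.exp (ΘP (τ i) x (pPt (Sum.inr (b, t))) - ΘP (τ j) y (Complex.I * u)) /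
              (Complex.I * u - pPt (Sum.inr (b, t))))) := by
  rw [← integral_const_mul, ← integral_const_mul, ← integral_const_mul]
  refine integral_congr_ae ?_
  filter_upwards [Measure.ae_ne volume (0 : ℝ)] with u hu
  simp only [pearceyQ, pearceyOffDiag, ht, hu, or_self, if_false, if_true]
  set μ := pPt (Sum.inr (b, t))
  have e : Complex.exp (ΘP (τ i) x μ - ΘP (τ j) y (Complex.I * u))
      = Complex.exp (ΘP (τ i) 0 μ / 2 - x * μ) * Complex.exp (ΘP (τ i) 0 μ / 2) *
        Complex.exp (-ΘP (τ j) 0 (Complex.I * u)) * Complex.exp (y * (Complex.I * u)) := by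
    rw [← Complex.exp_add, ← Complex.exp_add, ← Complex.exp_add]
    congr 1
    simp only [ΘP, Complex.ofReal_zero]
    ring
  rw [e, ← neg_sub μ, div_neg]
  ring

theorem kerComp_pearceyQ_kerComp_offDiag_pearceyB {τ : Fin n → ℝ} {J : Fin n → Set ℝ}
    {i j : Fin n} {x y : ℝ}
    (hFB : ∀ v, Integrable (fun w => pearceyOffDiag τ v w * pearceyB J w (j, y))
      ((Measure.count : Measure (Option Bool × Fin n)).prod volume))
    (hint : Integrable (fun v => pearceyQ τ J (i, x) v *
        kerComp ((Measure.count : Measure (Option Bool × Fin n)).prod volume) (pearceyOffDiag τ)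
          (pearceyB J) v (j, y))
      ((Measure.count : Measure (Option Bool × Fin n)).prod volume)) :
    kerComp ((Measure.count : Measure (Option Bool × Fin n)).prod volume) (pearceyQ τ J)
        (kerComp ((Measure.count : Measure (Option Bool × Fin n)).prod volume) (pearceyOffDiag τ)
          (pearceyB J)) (i, x) (j, y)
      = (J i).indicator (fun _ => (1 : ℂ)) x * pearceyTildeKer τ i j x y *
          (J j).indicator (fun _ => (1 : ℂ)) y := by
  have hsum : ∀ b : Bool, ∑ l : Fin n, ∫ t : ℝ, pearceyQ τ J (i, x) ((some b, l), t) *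
        kerComp ((Measure.count : Measure (Option Bool × Fin n)).prod volume) (pearceyOffDiag τ)
          (pearceyB J) ((some b, l), t) (j, y)
      = (J i).indicator (fun _ => (1 : ℂ)) x * (1 / (2 * (Real.pi : ℂ) * Complex.I)) ^ 2 *
          (J j).indicator (fun _ => (1 : ℂ)) y *
          ∫ t : ℝ, pWt (Sum.inr (b, t)) * ∫ u : ℝ, Complex.I *
            (Complex.exp (ΘP (τ i) x (pPt (Sum.inr (b, t))) - ΘP (τ j) y (Complex.I * u)) /
              (Complex.I * u - pPt (Sum.inr (b, t)))) := by
    intro b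
    rw [Finset.sum_eq_single i]
    · rw [← integral_const_mul]
      refine integral_congr_ae ?_
      filter_upwards [Measure.ae_ne volume (0 : ℝ)] with t ht
      rw [kerComp_pearceyB_right j y (hFB _)]
      exact pearceyQ_mul_integral_pearceyOffDiag τ J b i j x y ht
    · intro l _ hl
      simp [pearceyQ, hl.symm]
    · simp
  have hnone : ∀ (l : Fin n) (t : ℝ),
      kerComp ((Measure.count : Measure (Option Bool × Fin n)).prod volume) (pearceyOffDiag τ)
          (pearceyB J) ((none, l), t) (j, y) = 0 := by
    intro l t
    rw [kerComp_pearceyB_right j y (hFB _)]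
    simp [pearceyOffDiag]
  rw [kerComp, integral_count_prod hint, Fintype.sum_prod_type, Fintype.sum_option,
    Fintype.sum_bool, hsum, hsum]
  simp only [hnone, mul_zero, integral_zero, Finset.sum_const_zero, zero_add, pearceyTildeKer,
    pPt, pWt, if_true, Bool.false_eq_true, if_false]
  ring

end PearceyDeterminant

/-- Theorem `mainPearcey`.  The Fredholm determinant of the multi-time
matrix Pearcey operator restricted to the multi-intervals equals the Fredholm determinant
of the integrable (IIKS) operator `K_P` on `V = L²(iℝ,ℂⁿ) ⊕ L²(γ_L∪γ_R,ℂⁿ)` with kernel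
`K_P(λ,μ) = f_Pᵀ(λ)g_P(μ)/(λ-μ)`:  `det(Id - χ_{vec J} P) = det(Id - K_P)`. -/
theorem pearcey_fredholmDet_eq_IIKS (n : ℕ) (τ : Fin n → ℝ) (hτ : StrictMono τ)
    (k : Fin n → ℕ) (a : ∀ i, Fin (2 * k i) → ℝ) (ha : ∀ i, StrictMono (a i)) :
    fredholmDet (finLineMeasure n) (pearceyRestrictedKer τ k a)
      = fredholmDet (pVMeasure n) (pearceyKP τ k a) := by
  set J : Fin n → Set ℝ := fun i => multiInterval (a i) with hJdef
  have hm : ∀ i, MeasurableSet (J i) := fun i => measurableSet_multiInterval (a i)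
  have hJ : ∀ i, IsCompact (J i) := fun i => isCompact_multiInterval (a i)
  obtain ⟨c, hc0, hc1, hc⟩ := exists_gaussian_rate hτ
  obtain ⟨C₁, hC₁, hB₁⟩ := exists_isDominatedKernel_pearceyB hm
  obtain ⟨C₂, hC₂, hQ₂⟩ := exists_isDominatedKernel_pearceyQ (τ := τ) hm hJ hc1 hc
  obtain ⟨C₃, hC₃, hF₃⟩ := exists_isDominatedKernel_pearceyOffDiag τ hc1
  have hr := pearceyRowWeight_nonneg (n := n)
  have hs := pearceyColWeight_nonneg (n := n) c
  have hβ := pearceyChannelWeight_nonneg J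
  have hB := hB₁.mono hr hβ (show C₁ ≤ C₁ + C₂ + C₃ by linarith)
  have hQ := hQ₂.mono hβ hs (show C₂ ≤ C₁ + C₂ + C₃ by linarith)
  have hF := hF₃.mono hr hs (show C₃ ≤ C₁ + C₂ + C₃ by linarith)
  have hrs := integrable_pearceyRowWeight_mul_colWeight (n := n) hc0
  have hββ := integrable_pearceyChannelWeight_sq hm hJ
  have : SigmaFinite (finLineMeasure n) := by unfold finLineMeasure; infer_instance
  have hright : fredholmDet (pVMeasure n) (pearceyKP τ k a)
      = fredholmDet ((Measure.count : Measure (Option Bool × Fin n)).prod volume) (fun v w =>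
          kerComp (finLineMeasure n) (pearceyB J) (pearceyQ τ J) v w + pearceyOffDiag τ v w) := by
    rw [fredholmDet_comp_measurableEquiv (pearceyContourEquiv n)
      (measurePreserving_pearceyContourEquiv n)]
    refine fredholmDet_congr_ae (fun v => ?_) ?_
    · rw [pearceyKP_diag, kerComp_pearceyB_pearceyQ_diag, pearceyOffDiag_diag, add_zero]
    · filter_upwards [ae_abs_ne_abs (ι := Option Bool × Fin n)] with p hp
      exact pearceyKP_eq_kerComp_add τ k ha hc1 hc hp.1 hp.2.1 hp.2.2
  rw [hright, fredholmDet_kerComp_add hr hs hβ (by positivity) hrs hββ hQ hB hF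
    (pearceyOffDiag_diag τ) (kerComp_pearceyOffDiag_self τ _)]
  have hleft : pearceyRestrictedKer τ k a = fun p q =>
      Set.indicator {z : Fin n × ℝ | z.2 ∈ J z.1} (fun _ => (1 : ℂ)) p *
        pearceyPKer τ p.1 q.1 p.2 q.2 := rfl
  rw [hleft, fredholmDet_mul_indicator]
  congr 1
  funext ⟨i, x⟩ ⟨j, y⟩
  rw [kerComp_assoc hQ hF hB hrs hrs, kerComp_pearceyQ_pearceyB hτ (hQ.integrable_mul hB hrs _ _),
    kerComp_pearceyQ_kerComp_offDiag_pearceyB (fun v => hF.integrable_mul hB hrs v _)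
      (hQ.integrable_mul (hF.kerComp hB hrs) hrs _ _), pearceyPKer]
  simp only [show ∀ (l : Fin n) (w : ℝ), Set.indicator {z : Fin n × ℝ | z.2 ∈ J z.1}
    (fun _ => (1 : ℂ)) (l, w) = (J l).indicator (fun _ => (1 : ℂ)) w from fun _ _ => rfl]
  ring
end
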